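/- arXiv:1210.3733 — 6 statements merged into one kernel-verified Lean document; each statement's English description precedes it below -/
import Mathlib

section
/- The Warsaw Circle W = S ∪ A is path-connected and simply connected. -/
open Real Set

/-- The graph part of the Sine Curve: `{(x, sin (π / x)) : 0 < x ≤ 1}`. -/
def sineGraph : Set (ℝ × ℝ) :=
  {p | ∃ x : ℝ, 0 < x ∧ x ≤ 1 ∧ p = (x, Real.sin (Real.pi / x))}

/-- The Sine Curve: the graph together with the vertical segment `{0} × [-1, 1]`. -/
def SineCurve : Set (ℝ × ℝ) :=
  sineGraph ∪ ({0} : Set ℝ) ×ˢ Icc (-1 : ℝ) 1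

/-- The arc `A = ({1} × [-2,0]) ∪ ([0,1] × {-2}) ∪ ({0} × [-2,-1])` joining `(1,0)` to
`(0,-1)` and meeting the Sine Curve only in these two endpoints. -/
def warsawArc : Set (ℝ × ℝ) :=
  ({1} : Set ℝ) ×ˢ Icc (-2 : ℝ) 0 ∪ Icc (0 : ℝ) 1 ×ˢ ({-2} : Set ℝ) ∪
    ({0} : Set ℝ) ×ˢ Icc (-2 : ℝ) (-1)

/-- The Warsaw Circle: the Sine Curve together with the arc `A`. -/
def WarsawCircle : Set (ℝ × ℝ) := SineCurve ∪ warsawArc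

open Topology

/-- A space onto which a simply connected space maps continuously, with a set-theoretic section
along which every path lifts continuously, is simply connected. -/
theorem simplyConnectedSpace_of_path_lifting {E X : Type*} [TopologicalSpace E]
    [TopologicalSpace X] [SimplyConnectedSpace E] {f : E → X} (hf : Continuous f) (g : X → E)
    (hfg : Function.LeftInverse f g)
    (hg : ∀ γ : unitInterval → X, Continuous γ → Continuous (g ∘ γ)) :
    SimplyConnectedSpace X := by
  rw [simply_connected_iff_paths_homotopic']
  refine ⟨hfg.surjective.pathConnectedSpace hf, fun {x y} p q ↦ ?_⟩
  let lift (p : Path x y) : Path (g x) (g y) :=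
    { toFun := g ∘ p
      continuous_toFun := hg p p.continuous
      source' := by simp
      target' := by simp }
  have map_lift (p : Path x y) : ((lift p).map hf).cast (hfg x).symm (hfg y).symm = p := by
    ext t
    exact hfg (p t)
  obtain ⟨F⟩ := (SimplyConnectedSpace.paths_homotopic (lift p) (lift q)).map ⟨f, hf⟩
  rw [← map_lift p, ← map_lift q]
  exact ⟨F.pathCast (hfg x).symm (hfg y).symm⟩

theorem mem_warsawCircle_iff {p : ℝ × ℝ} :
    p ∈ WarsawCircle ↔ p ∈ sineGraph ∨ (p.1 = 0 ∧ p.2 ∈ Icc (-2) 1) ∨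
      (p.1 ∈ Icc 0 1 ∧ p.2 = -2) ∨ (p.1 = 1 ∧ p.2 ∈ Icc (-2) 0) := by
  simp only [WarsawCircle, SineCurve, warsawArc, mem_union, mem_prod, mem_singleton_iff, mem_Icc]
  constructor
  · rintro ((h | ⟨h, h1, h2⟩) | (⟨h, h1, h2⟩ | h) | ⟨h, h1, h2⟩)
    · exact .inl h
    · exact .inr (.inl ⟨h, by linarith, h2⟩)
    · exact .inr (.inr (.inr ⟨h, h1, h2⟩))
    · exact .inr (.inr (.inl h))
    · exact .inr (.inl ⟨h, h1, by linarith⟩)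
  · rintro (h | ⟨h, h1, h2⟩ | h | h)
    · exact .inl (.inl h)
    · rcases le_total p.2 (-1) with h3 | h3
      · exact .inr (.inr ⟨h, h1, h3⟩)
      · exact .inl (.inr ⟨h, h3, h2⟩)
    · exact .inr (.inl (.inr h))
    · exact .inr (.inl (.inl h))

theorem mem_sineGraph_iff {p : ℝ × ℝ} :
    p ∈ sineGraph ↔ 0 < p.1 ∧ p.1 ≤ 1 ∧ p.2 = Real.sin (π / p.1) := by
  constructor
  · rintro ⟨x, h0, h1, rfl⟩
    exact ⟨h0, h1, rfl⟩
  · rintro ⟨h0, h1, h⟩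
    exact ⟨p.1, h0, h1, Prod.ext rfl h⟩

theorem WarsawCircle.fst_mem_Icc {p : ℝ × ℝ} (hp : p ∈ WarsawCircle) : p.1 ∈ Icc 0 1 := by
  rcases mem_warsawCircle_iff.1 hp with h | h | h | h
  · exact ⟨(mem_sineGraph_iff.1 h).1.le, (mem_sineGraph_iff.1 h).2.1⟩
  · simp [h.1]
  · exact h.1
  · simp [h.1]

/-- A parametrization of the Warsaw circle by `ℝ`: down the left segment, along the bottom, up the
right segment, and then back along the sine curve. -/
noncomputable def warsawParam (t : ℝ) : ℝ × ℝ :=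
  (min (max t 0) 1 / max 1 (t - 2),
    min 1 (max (-2 - t) (-2)) + max 0 (min (t - 1) 2) + Real.sin (π * max 1 (t - 2)))

theorem continuous_warsawParam : Continuous warsawParam := by
  unfold warsawParam
  refine .prodMk (.div (by fun_prop) (by fun_prop) fun t ↦ ?_) (by fun_prop)
  exact (lt_of_lt_of_le one_pos (le_max_left _ _)).ne'

theorem warsawParam_of_le_zero {t : ℝ} (ht : t ≤ 0) : warsawParam t = (0, min 1 (-2 - t)) := by
  simp only [warsawParam]
  rw [max_eq_right ht, max_eq_left (by linarith : t - 2 ≤ 1),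
    max_eq_left (by linarith : -2 ≤ -2 - t), min_eq_left (by linarith : t - 1 ≤ 2),
    max_eq_left (by linarith : t - 1 ≤ 0)]
  simp

theorem warsawParam_of_mem_Icc_zero_one {t : ℝ} (ht : t ∈ Icc 0 1) :
    warsawParam t = (t, -2) := by
  obtain ⟨h0, h1⟩ := ht
  simp only [warsawParam]
  rw [max_eq_left h0, min_eq_left h1, max_eq_left (by linarith : t - 2 ≤ 1),
    max_eq_right (by linarith : -2 - t ≤ -2), min_eq_left (by linarith : t - 1 ≤ 2),
    max_eq_left (by linarith : t - 1 ≤ 0)]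
  norm_num

theorem warsawParam_of_mem_Icc_one_three {t : ℝ} (ht : t ∈ Icc 1 3) :
    warsawParam t = (1, t - 3) := by
  obtain ⟨h1, h3⟩ := ht
  simp only [warsawParam]
  rw [max_eq_left (by linarith : 0 ≤ t), min_eq_right h1, max_eq_left (by linarith : t - 2 ≤ 1),
    max_eq_right (by linarith : -2 - t ≤ -2), min_eq_left (by linarith : t - 1 ≤ 2),
    max_eq_right (by linarith : 0 ≤ t - 1), min_eq_right (by norm_num)]
  simp only [mul_one, Real.sin_pi, div_one, Prod.mk.injEq, true_and]
  ring

theorem warsawParam_of_three_le {t : ℝ} (ht : 3 ≤ t) :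
    warsawParam t = (1 / (t - 2), Real.sin (π * (t - 2))) := by
  simp only [warsawParam]
  rw [max_eq_left (by linarith : 0 ≤ t), min_eq_right (by linarith : 1 ≤ t),
    max_eq_right (by linarith : 1 ≤ t - 2),
    max_eq_right (by linarith : -2 - t ≤ -2), min_eq_right (by linarith : 2 ≤ t - 1)]
  norm_num

theorem warsawParam_mem (t : ℝ) : warsawParam t ∈ WarsawCircle := by
  rw [mem_warsawCircle_iff]
  rcases le_total t 0 with h0 | h0
  · rw [warsawParam_of_le_zero h0]
    exact .inr (.inl ⟨rfl, le_min (by norm_num) (by linarith), min_le_left _ _⟩)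
  rcases le_total t 1 with h1 | h1
  · rw [warsawParam_of_mem_Icc_zero_one ⟨h0, h1⟩]
    exact .inr (.inr (.inl ⟨⟨h0, h1⟩, rfl⟩))
  rcases le_total t 3 with h3 | h3
  · rw [warsawParam_of_mem_Icc_one_three ⟨h1, h3⟩]
    exact .inr (.inr (.inr ⟨rfl, by simp only; linarith, by simp only; linarith⟩))
  · rw [warsawParam_of_three_le h3]
    refine .inl ⟨1 / (t - 2), by apply one_div_pos.2; linarith, ?_, by simp⟩
    rw [div_le_one (by linarith)]
    linarith

open Classical in
/-- A (discontinuous) section of `warsawParam` over the Warsaw circle. -/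
noncomputable def warsawSection (p : ℝ × ℝ) : ℝ :=
  if p ∈ sineGraph then 2 + 1 / p.1 else p.1 + (2 + p.2) * (2 * p.1 - 1)

theorem warsawParam_warsawSection {p : ℝ × ℝ} (hp : p ∈ WarsawCircle) :
    warsawParam (warsawSection p) = p := by
  by_cases h : p ∈ sineGraph
  · rw [warsawSection, if_pos h]
    obtain ⟨x, h0, h1, rfl⟩ := h
    rw [warsawParam_of_three_le (by linarith [one_le_one_div h0 h1])]
    simp [div_eq_mul_inv]
  · rw [warsawSection, if_neg h]
    obtain ⟨x, y⟩ := p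
    rcases mem_warsawCircle_iff.1 hp with h' | ⟨rfl, h1, h2⟩ | ⟨h1, rfl⟩ | ⟨rfl, h1, h2⟩
    · exact absurd h' h
    · simp only at h1 h2 ⊢
      rw [warsawParam_of_le_zero (by linarith)]
      exact Prod.ext rfl (by simp only; rw [min_eq_right] <;> linarith)
    · simp only at h1 ⊢
      rw [warsawParam_of_mem_Icc_zero_one (by simpa using h1)]
      simp
    · simp only at h1 h2 ⊢
      rw [warsawParam_of_mem_Icc_one_three ⟨by linarith, by linarith⟩]
      exact Prod.ext rfl (by ring)

/-- Near `0`, the function `sin (π / a)` leaves every interval of radius `1 / 2`. -/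
theorem exists_half_le_abs_sin_pi_div_sub {c : ℝ} (hc : 0 < c) (y : ℝ) :
    ∃ a ∈ Ioo 0 c, 1 / 2 ≤ |Real.sin (π / a) - y| := by
  obtain ⟨n, hn⟩ := exists_nat_gt (1 / c)
  have key {r : ℝ} (hr : 0 < r) : 1 / (2 * n + r) ∈ Ioo 0 c := by
    refine ⟨by positivity, ?_⟩
    rw [one_div_lt (by positivity) hc]
    have : (0 : ℝ) ≤ n := n.cast_nonneg
    linarith
  rcases le_total y 0 with hy | hy
  · refine ⟨_, key (r := 1 / 2) (by norm_num), ?_⟩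
    have : π / (1 / (2 * n + 1 / 2)) = π / 2 + n * (2 * π) := by
      rw [div_div_eq_mul_div]; ring
    rw [this, Real.sin_add_nat_mul_two_pi, Real.sin_pi_div_two]
    exact le_abs.2 (.inl (by linarith))
  · refine ⟨_, key (r := 3 / 2) (by norm_num), ?_⟩
    have : π / (1 / (2 * n + 3 / 2)) = π / 2 + π + n * (2 * π) := by
      rw [div_div_eq_mul_div]; ring
    rw [this, Real.sin_add_nat_mul_two_pi, Real.sin_add_pi, Real.sin_pi_div_two]
    exact le_abs.2 (.inr (by linarith))

/-- A continuous map from a locally connected space to the Warsaw circle cannot approach the limit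
segment along the sine graph. -/
theorem isClosed_preimage_sineGraph {Z : Type*} [TopologicalSpace Z] [LocallyConnectedSpace Z]
    {γ : Z → ℝ × ℝ} (hγ : Continuous γ) (hW : ∀ t, γ t ∈ WarsawCircle) :
    IsClosed (γ ⁻¹' sineGraph) := by
  rw [← isOpen_compl_iff, isOpen_iff_eventually]
  intro t₀ ht₀
  rcases (WarsawCircle.fst_mem_Icc (hW t₀)).1.eq_or_lt with h0 | h0
  · have hnear : ∀ᶠ t in 𝓝 t₀, |(γ t).2 - (γ t₀).2| < 1 / 2 := by
      have : Continuous fun t ↦ |(γ t).2 - (γ t₀).2| := by fun_prop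
      exact this.continuousAt.eventually_lt continuousAt_const (by simp)
    obtain ⟨U, ⟨hUo, htU, hUc⟩, hU⟩ :=
      (LocallyConnectedSpace.open_connected_basis t₀).mem_iff.1 hnear
    filter_upwards [hUo.mem_nhds htU] with t₁ ht₁ hmem
    rw [mem_preimage, mem_sineGraph_iff] at hmem
    obtain ⟨hpos, hle, hsin⟩ := hmem
    obtain ⟨a, ⟨ha0, hac⟩, ha⟩ := exists_half_le_abs_sin_pi_div_sub hpos (γ t₀).2
    obtain ⟨s, hsU, rfl⟩ := hUc.isPreconnected.intermediate_value htU ht₁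
      (continuous_fst.comp hγ).continuousOn ⟨by simpa [← h0] using ha0.le, hac.le⟩
    simp only [Function.comp_apply] at ha0 hac ha
    have hs' : |(γ s).2 - (γ t₀).2| < 1 / 2 := hU hsU
    have hs := abs_lt.1 hs'
    have ht := abs_lt.1 (show |(γ t₁).2 - (γ t₀).2| < 1 / 2 from hU ht₁)
    have := Real.neg_one_le_sin (π / (γ t₁).1)
    rcases mem_warsawCircle_iff.1 (hW s) with h | h | h | h
    · rw [← (mem_sineGraph_iff.1 h).2.2] at ha
      exact absurd hs' ha.not_gt
    · exact ha0.ne' h.1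
    · linarith [h.2]
    · linarith [h.1]
  · have hsin : ContinuousAt (fun t ↦ Real.sin (π / (γ t).1)) t₀ :=
      Real.continuous_sin.continuousAt.comp
        (continuousAt_const.div (by fun_prop) h0.ne')
    have hsnd : ContinuousAt (fun t ↦ (γ t).2) t₀ := by fun_prop
    have hne : (γ t₀).2 ≠ Real.sin (π / (γ t₀).1) := fun h ↦
      ht₀ (mem_sineGraph_iff.2 ⟨h0, (WarsawCircle.fst_mem_Icc (hW t₀)).2, h⟩)
    filter_upwards [(hsnd.ne_iff_eventually_ne hsin).1 hne] with t ht hmem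
    exact ht (mem_sineGraph_iff.1 hmem).2.2

theorem continuous_warsawSection_comp {Z : Type*} [TopologicalSpace Z] [LocallyConnectedSpace Z]
    {γ : Z → ℝ × ℝ} (hγ : Continuous γ) (hW : ∀ t, γ t ∈ WarsawCircle) :
    Continuous (warsawSection ∘ γ) := by
  let B : Set (ℝ × ℝ) := {p | p.1 = 0 ∨ p.2 = -2 ∨ p.1 = 1}
  have hB : IsClosed B :=
    (isClosed_eq continuous_fst continuous_const).union
      ((isClosed_eq continuous_snd continuous_const).union
        (isClosed_eq continuous_fst continuous_const))
  have hcover : γ ⁻¹' sineGraph ∪ γ ⁻¹' B = univ := by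
    refine eq_univ_of_forall fun t ↦ ?_
    rcases mem_warsawCircle_iff.1 (hW t) with h | h | h | h
    · exact .inl h
    · exact .inr (.inl h.1)
    · exact .inr (.inr (.inl h.2))
    · exact .inr (.inr (.inr h.1))
  rw [← continuousOn_univ, ← hcover]
  refine ContinuousOn.union_of_isClosed ?_ ?_ (isClosed_preimage_sineGraph hγ hW)
    (hB.preimage hγ)
  · have : ContinuousOn (fun t ↦ 2 + 1 / (γ t).1) (γ ⁻¹' sineGraph) :=
      continuousOn_const.add (continuousOn_const.div (by fun_prop)
        fun t ht ↦ (mem_sineGraph_iff.1 ht).1.ne')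
    exact this.congr fun t ht ↦ if_pos ht
  · have : Continuous fun t ↦ (γ t).1 + (2 + (γ t).2) * (2 * (γ t).1 - 1) := by fun_prop
    refine this.continuousOn.congr fun t ht ↦ ?_
    by_cases h : γ t ∈ sineGraph
    · simp only [Function.comp_apply, warsawSection, if_pos h]
      obtain ⟨hpos, -, hsin⟩ := mem_sineGraph_iff.1 h
      rcases ht with h' | h' | h'
      · exact absurd h' hpos.ne'
      · linarith [Real.neg_one_le_sin (π / (γ t).1)]
      · rw [hsin, h']
        norm_num
    · exact if_neg h

/-- The Warsaw Circle `W = S ∪ A` is path-connected and simply connected. -/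
theorem warsawCircle_pathConnected_simplyConnected :
    IsPathConnected WarsawCircle ∧ SimplyConnectedSpace WarsawCircle := by
  have : LocallyPathConnectedSpace unitInterval :=
    (convex_Icc (0 : ℝ) 1).locallyPathConnectedSpace
  have hconn : SimplyConnectedSpace WarsawCircle :=
    simplyConnectedSpace_of_path_lifting
      (continuous_warsawParam.subtype_mk warsawParam_mem) (fun p ↦ warsawSection p)
      (fun p ↦ Subtype.ext (warsawParam_warsawSection p.2))
      fun γ hγ ↦ continuous_warsawSection_comp (continuous_subtype_val.comp hγ) fun t ↦ (γ t).2
  exact ⟨isPathConnected_iff_pathConnectedSpace.2 inferInstance, hconn⟩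
end

section
/- Zeeman's Palm ZP = D ∪ A' is path-connected and simply connected. -/
open Set

/-- The infinite broom: the union over all integers `n ≥ 1` of the straight segments
joining `(0,0)` to `(1, 1/n)`. -/
def InfiniteBroom : Set (ℝ × ℝ) :=
  ⋃ n ∈ {n : ℤ | 1 ≤ n}, segment ℝ ((0 : ℝ), (0 : ℝ)) ((1 : ℝ), (n : ℝ)⁻¹)

/-- The Dusty Broom: the infinite broom together with the speck of dust `(1, 0)`. -/
def DustyBroom : Set (ℝ × ℝ) :=
  InfiniteBroom ∪ {((1 : ℝ), (0 : ℝ))}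

/-- The arc `A' = ({0} × [-1,0]) ∪ ([0,1] × {-1}) ∪ ({1} × [-1,0])` joining `(0,0)` to
`(1,0)` and meeting the Dusty Broom only in these two endpoints. -/
def palmArc : Set (ℝ × ℝ) :=
  ({0} : Set ℝ) ×ˢ Icc (-1 : ℝ) 0 ∪ Icc (0 : ℝ) 1 ×ˢ ({-1} : Set ℝ) ∪
    ({1} : Set ℝ) ×ˢ Icc (-1 : ℝ) 0

/-- Zeeman's Palm: the Dusty Broom together with the arc `A'`. -/
def ZeemansPalm : Set (ℝ × ℝ) := DustyBroom ∪ palmArc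

open Filter Topology unitInterval

/-- A space receiving a continuous map from a simply connected space is itself simply connected
when this map has a right inverse which, though possibly discontinuous, preserves the continuity
of paths. -/
theorem SimplyConnectedSpace.of_path_lifting {X Y : Type*} [TopologicalSpace X]
    [TopologicalSpace Y] [SimplyConnectedSpace X] {f : X → Y} {g : Y → X} (hf : Continuous f)
    (hfg : Function.RightInverse g f)
    (hg : ∀ p : I → Y, Continuous p → Continuous (g ∘ p)) : SimplyConnectedSpace Y := by
  refine simply_connected_iff_paths_homotopic'.2
    ⟨hfg.surjective.pathConnectedSpace hf, fun {x y} p₁ p₂ => ?_⟩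
  let lift (p : Path x y) : Path (g x) (g y) :=
    { toFun := g ∘ p
      continuous_toFun := hg p p.continuous
      source' := by simp
      target' := by simp }
  have h := ((SimplyConnectedSpace.paths_homotopic (lift p₁) (lift p₂)).map ⟨f, hf⟩).pathCast
    (hfg x).symm (hfg y).symm
  have key (p : Path x y) :
      ((lift p).map hf).cast (hfg x).symm (hfg y).symm = p :=
    Path.ext (funext fun t => hfg (p t))
  rw [← key p₁, ← key p₂]
  exact h

theorem mem_infiniteBroom_iff {z : ℝ × ℝ} :
    z ∈ InfiniteBroom ↔ ∃ n : ℤ, 1 ≤ n ∧ z.1 ∈ Icc (0 : ℝ) 1 ∧ z.2 = z.1 * (n : ℝ)⁻¹ := by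
  obtain ⟨x, y⟩ := z
  simp only [InfiniteBroom, mem_iUnion, segment_eq_image, mem_image, Prod.smul_mk, Prod.mk_add_mk,
    smul_eq_mul, mul_zero, mul_one, zero_add, Prod.mk.injEq, mem_ofPred_eq, exists_prop]
  constructor
  · rintro ⟨n, hn, θ, hθ, rfl, rfl⟩
    exact ⟨n, hn, hθ, rfl⟩
  · rintro ⟨n, hn, hx, rfl⟩
    exact ⟨n, hn, x, hx, rfl, rfl⟩

/-- The infinite broom with the arc of Zeeman's Palm straightened out and detached from the
speck of dust: the continuous bijective image of this star-shaped set is Zeeman's Palm. -/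
def StraightenedPalm : Set (ℝ × ℝ) := InfiniteBroom ∪ Icc (-3 : ℝ) 0 ×ˢ {0}

theorem starConvex_straightenedPalm : StarConvex ℝ 0 StraightenedPalm := by
  refine (starConvex_iUnion₂ fun n _ => ?_).union ?_
  · exact (convex_segment _ _).starConvex (left_mem_segment _ _ _)
  · exact ((convex_Icc _ _).prod (convex_singleton _)).starConvex (by norm_num)

instance : ContractibleSpace StraightenedPalm :=
  starConvex_straightenedPalm.contractibleSpace ⟨0, Or.inr (by norm_num)⟩

/-- The map bending `StraightenedPalm` into Zeeman's Palm. -/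
def bendPalm (z : ℝ × ℝ) : ℝ × ℝ :=
  (max z.1 0 + max 0 (min 1 (-z.1 - 1)),
    z.2 + max (max (-max (-z.1) 0) (max (-z.1) 0 - 3)) (-1))

/-- The arc length along `palmArc`, starting from the origin. -/
def palmArcLength (z : ℝ × ℝ) : ℝ := -z.2 + z.1 * (3 + 2 * z.2)

/-- The right inverse of `bendPalm`, discontinuous at the speck of dust. -/
noncomputable def unbendPalm (z : ℝ × ℝ) : ℝ × ℝ :=
  if 0 < z.2 then z else (-palmArcLength z, 0)

theorem continuous_bendPalm : Continuous bendPalm := by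
  unfold bendPalm
  fun_prop

theorem continuous_palmArcLength : Continuous palmArcLength := by
  unfold palmArcLength
  fun_prop

theorem mem_palmArc_iff {z : ℝ × ℝ} : z ∈ palmArc ↔
    (z.1 = 0 ∧ -1 ≤ z.2 ∧ z.2 ≤ 0) ∨ ((0 ≤ z.1 ∧ z.1 ≤ 1) ∧ z.2 = -1) ∨
      (z.1 = 1 ∧ -1 ≤ z.2 ∧ z.2 ≤ 0) := by
  simp [palmArc, mem_prod, or_assoc]

theorem mem_infiniteBroom_of_pos {z : ℝ × ℝ} (hz : z ∈ ZeemansPalm) (h : 0 < z.2) :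
    z ∈ InfiniteBroom := by
  rcases hz with (hz | rfl) | hz
  · exact hz
  · exact absurd h (lt_irrefl _)
  · rw [mem_palmArc_iff] at hz
    exfalso
    rcases hz with ⟨_, _, _⟩ | ⟨_, _⟩ | ⟨_, _, _⟩ <;> linarith

theorem mem_palmArc_of_nonpos {z : ℝ × ℝ} (hz : z ∈ ZeemansPalm) (h : z.2 ≤ 0) :
    z ∈ palmArc := by
  rcases hz with (hz | rfl) | hz
  · obtain ⟨n, hn, ⟨h0, -⟩, hy⟩ := mem_infiniteBroom_iff.1 hz
    have hn' : (0 : ℝ) < (n : ℝ)⁻¹ := by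
      have : (1 : ℝ) ≤ n := mod_cast hn
      positivity
    have hx : z.1 = 0 := by
      by_contra hne
      have := mul_pos (lt_of_le_of_ne h0 (Ne.symm hne)) hn'
      linarith
    exact mem_palmArc_iff.2 (Or.inl ⟨hx, by simp [hy, hx], h⟩)
  · exact mem_palmArc_iff.2 (by norm_num)
  · exact hz

theorem bendPalm_of_nonneg {z : ℝ × ℝ} (h : 0 ≤ z.1) : bendPalm z = z := by
  ext <;> simp only [bendPalm] <;> grind

theorem bendPalm_mem {z : ℝ × ℝ} (hz : z ∈ StraightenedPalm) : bendPalm z ∈ ZeemansPalm := by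
  rcases hz with hz | ⟨⟨h₃, h₀⟩, hy⟩
  · obtain ⟨n, hn, ⟨h0, -⟩, -⟩ := mem_infiniteBroom_iff.1 hz
    rw [bendPalm_of_nonneg h0]
    exact Or.inl (Or.inl hz)
  · refine Or.inr (mem_palmArc_iff.2 ?_)
    obtain ⟨x, y⟩ := z
    simp only [mem_singleton_iff] at h₃ h₀ hy
    subst hy
    simp only [bendPalm]
    grind

theorem unbendPalm_mem {z : ℝ × ℝ} (hz : z ∈ ZeemansPalm) : unbendPalm z ∈ StraightenedPalm := by
  unfold unbendPalm
  split_ifs with h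
  · exact Or.inl (mem_infiniteBroom_of_pos hz h)
  · refine Or.inr ⟨?_, rfl⟩
    rcases mem_palmArc_iff.1 (mem_palmArc_of_nonpos hz (not_lt.1 h)) with
      ⟨hx, _, _⟩ | ⟨⟨_, _⟩, hy⟩ | ⟨hx, _, _⟩ <;>
    constructor <;> simp only [palmArcLength, *] <;> linarith

theorem bendPalm_unbendPalm {z : ℝ × ℝ} (hz : z ∈ ZeemansPalm) : bendPalm (unbendPalm z) = z := by
  unfold unbendPalm
  split_ifs with h
  · obtain ⟨n, hn, ⟨h0, -⟩, -⟩ := mem_infiniteBroom_iff.1 (mem_infiniteBroom_of_pos hz h)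
    exact bendPalm_of_nonneg h0
  · obtain ⟨x, y⟩ := z
    rcases mem_palmArc_iff.1 (mem_palmArc_of_nonpos hz (not_lt.1 h)) with
      ⟨hx, _, _⟩ | ⟨⟨_, _⟩, hy⟩ | ⟨hx, _, _⟩ <;>
    ext <;> simp only [palmArcLength, bendPalm] at * <;> subst_vars <;> grind

/-- A connected set of points of Zeeman's Palm close to the speck of dust cannot contain both a
point of the arc and a point off the arc. -/
theorem snd_nonpos_of_isPreconnected {T : Type*} [TopologicalSpace T] {p : T → ℝ × ℝ}
    (hp : Continuous p) (hmem : ∀ t, p t ∈ ZeemansPalm) {V : Set T} (hV : IsPreconnected V)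
    (hpos : ∀ t ∈ V, 0 < (p t).1) {a b : T} (ha : a ∈ V) (hb : b ∈ V) (ha0 : (p a).2 ≤ 0) :
    (p b).2 ≤ 0 := by
  by_contra! hb0
  obtain ⟨n, hn, -, hy⟩ := mem_infiniteBroom_iff.1 (mem_infiniteBroom_of_pos (hmem b) hb0)
  have hn' : (1 : ℝ) ≤ n := mod_cast hn
  have hcont : ContinuousOn (fun t => (p t).2 / (p t).1) V :=
    (continuous_snd.comp hp).continuousOn.div (continuous_fst.comp hp).continuousOn
      fun t ht => (hpos t ht).ne'
  have hslope : (p b).2 / (p b).1 = (n : ℝ)⁻¹ := by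
    rw [hy, mul_div_cancel_left₀ _ (hpos b hb).ne']
  have hbetween : ((n : ℝ) + 1 / 2)⁻¹ ∈ Icc ((p a).2 / (p a).1) ((p b).2 / (p b).1) := by
    refine ⟨(div_nonpos_of_nonpos_of_nonneg ha0 (hpos a ha).le).trans (by positivity), ?_⟩
    rw [hslope]
    gcongr
    linarith
  obtain ⟨c, hc, hcs⟩ := hV.intermediate_value ha hb hcont hbetween
  have hcpos := hpos c hc
  simp only at hcs
  have hc2 : 0 < (p c).2 := by
    have : 0 < (p c).2 / (p c).1 := by rw [hcs]; positivity
    exact (div_pos_iff_of_pos_right hcpos).1 this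
  obtain ⟨m, hm, -, hmy⟩ := mem_infiniteBroom_iff.1 (mem_infiniteBroom_of_pos (hmem c) hc2)
  rw [hmy, mul_div_cancel_left₀ _ hcpos.ne', inv_inj] at hcs
  have h1 : (n : ℝ) < m := by linarith
  have h2 : (m : ℝ) < (n + 1 : ℤ) := by push_cast; linarith
  have h1' : n < m := mod_cast h1
  have h2' : m < n + 1 := mod_cast h2
  omega

theorem continuous_unbendPalm_comp {T : Type*} [TopologicalSpace T] [LocallyConnectedSpace T]
    {p : T → ℝ × ℝ} (hp : Continuous p) (hmem : ∀ t, p t ∈ ZeemansPalm) :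
    Continuous (unbendPalm ∘ p) := by
  have harc : Continuous fun z : ℝ × ℝ => (-palmArcLength z, (0 : ℝ)) :=
    continuous_palmArcLength.neg.prodMk continuous_const
  have hsnd : Continuous fun t => (p t).2 := continuous_snd.comp hp
  rw [continuous_iff_continuousAt]
  intro t
  by_cases hx : 0 < (p t).1 ∧ (p t).2 ≤ 0
  · have hopen : IsOpen {s | 0 < (p s).1} := isOpen_lt continuous_const (continuous_fst.comp hp)
    obtain ⟨V, hVU, hVo, htV, hVc⟩ := locallyConnectedSpace_iff_subsets_isOpen_isConnected.1
      ‹_› t _ (hopen.mem_nhds hx.1)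
    refine (harc.comp hp).continuousAt.congr ?_
    filter_upwards [hVo.mem_nhds htV] with s hs
    have := snd_nonpos_of_isPreconnected hp hmem hVc.isPreconnected hVU htV hs hx.2
    simp [unbendPalm, this.not_gt]
  refine ContinuousAt.comp (f := p) ?_ hp.continuousAt
  rcases lt_trichotomy 0 (p t).2 with h | h | h
  · refine continuousAt_id.congr ?_
    filter_upwards [(isOpen_lt continuous_const continuous_snd).mem_nhds h] with z hz
    exact (if_pos hz).symm
  · have h0 : p t = 0 := by
      have hfst : (p t).1 = 0 := by
        rcases mem_palmArc_iff.1 (mem_palmArc_of_nonpos (hmem t) h.ge) with h' | h' | h'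
        · exact h'.1
        · linarith [h'.2]
        · exact absurd ⟨by linarith [h'.1], h.ge⟩ hx
      exact Prod.ext hfst h.symm
    rw [h0]
    have harc0 : (-palmArcLength 0, (0 : ℝ)) = 0 := by simp [palmArcLength]
    have hun0 : unbendPalm 0 = 0 := by simp [unbendPalm, harc0]
    rw [ContinuousAt, hun0]
    refine Tendsto.if (tendsto_id.mono_left inf_le_left) (Tendsto.mono_left ?_ inf_le_left)
    simpa only [harc0] using harc.tendsto 0
  · refine harc.continuousAt.congr ?_
    filter_upwards [(isOpen_lt continuous_snd continuous_const).mem_nhds h] with z hz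
    exact (if_neg (not_lt.2 (le_of_lt hz))).symm

/-- Zeeman's Palm `ZP = D ∪ A'` is path-connected and simply connected. -/
theorem zeemansPalm_pathConnected_simplyConnected :
    IsPathConnected ZeemansPalm ∧ SimplyConnectedSpace ZeemansPalm := by
  have : LocallyPathConnectedSpace I := (convex_Icc (0 : ℝ) 1).locallyPathConnectedSpace
  have h : SimplyConnectedSpace ZeemansPalm :=
    SimplyConnectedSpace.of_path_lifting (X := StraightenedPalm)
      (f := fun z => ⟨bendPalm z, bendPalm_mem z.2⟩)
      (g := fun z => ⟨unbendPalm z, unbendPalm_mem z.2⟩)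
      ((continuous_bendPalm.comp continuous_subtype_val).subtype_mk _)
      (fun z => Subtype.ext (bendPalm_unbendPalm z.2))
      fun p hp => (continuous_unbendPalm_comp (continuous_subtype_val.comp hp)
        fun t => (p t).2).subtype_mk _
  exact ⟨isPathConnected_iff_pathConnectedSpace.2 inferInstance, h⟩
end

section
/- There exist a topological space E and a map p : E → W onto the Warsaw Circle such that p is a covering map, every fiber of p has exactly two elements, and E is connected but not path-connected; moreover E has exactly two path components, each of which is simply connected. -/
open Real Set

open Topology Filter unitInterval

/-- A space onto which a simply connected space maps is simply connected as soon as paths lift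
through a (possibly discontinuous) section. -/
theorem SimplyConnectedSpace.of_path_lifting_section {X Y : Type*} [TopologicalSpace X]
    [TopologicalSpace Y] [SimplyConnectedSpace Y] (g : C(Y, X)) (r : X → Y)
    (hgr : ∀ x, g (r x) = x) (hr : ∀ {x y : X} (q : Path x y), Continuous (r ∘ q)) :
    SimplyConnectedSpace X := by
  rw [simply_connected_iff_paths_homotopic']
  refine ⟨Function.Surjective.pathConnectedSpace (fun x ↦ ⟨r x, hgr x⟩) g.continuous, ?_⟩
  intro x y q q'
  let lift (q : Path x y) : Path (r x) (r y) := ⟨⟨r ∘ q, hr q⟩, by simp, by simp⟩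
  have key (q : Path x y) :
      q = ((lift q).map g.continuous).cast (hgr x).symm (hgr y).symm := by
    ext t
    simp [lift, hgr]
  rw [key q, key q']
  exact (paths_homotopic (lift q) (lift q')).map g

section Lifts

variable {E W : Type*} [TopologicalSpace E] [TopologicalSpace W] {p : E → W}
  {f : C(ℝ, W)} {τ : W → ℝ} {g : C(ℝ, E)}

/-- If every path of the base of a covering reparametrizes a curve, then the path component of a
point on a lift of that curve is the trace of the lift. -/
theorem IsCoveringMap.mem_pathComponent_iff (hp : IsCoveringMap p) (hfτ : ∀ w, f (τ w) = w)
    (hτ : ∀ q : C(I, W), Continuous (τ ∘ q)) (hg : p ∘ g = f) {e : E} (he : g (τ (p e)) = e)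
    {x : E} : x ∈ pathComponent e ↔ g (τ (p x)) = x := by
  constructor
  · rintro ⟨q⟩
    let q₀ : C(I, W) := ⟨p ∘ q, hp.continuous.comp q.continuous⟩
    have h : g ∘ (τ ∘ q₀) = q := by
      refine hp.eq_of_comp_eq (g.continuous.comp (hτ q₀)) q.continuous ?_ 0 (by simp [q₀, he])
      rw [← Function.comp_assoc, hg]
      ext t
      simp [q₀, hfτ]
    simpa [q₀] using congr_fun h 1
  · intro hx
    have := (PathConnectedSpace.joined (τ (p e)) (τ (p x))).map g.continuous
    rwa [he, hx] at this

theorem IsCoveringMap.simplyConnectedSpace_pathComponent (hp : IsCoveringMap p)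
    (hfτ : ∀ w, f (τ w) = w) (hτ : ∀ q : C(I, W), Continuous (τ ∘ q)) (hg : p ∘ g = f)
    {e : E} (he : g (τ (p e)) = e) : SimplyConnectedSpace (pathComponent e) := by
  have hmem (t : ℝ) : g t ∈ pathComponent e := by
    have := (PathConnectedSpace.joined (τ (p e)) t).map g.continuous
    rwa [he] at this
  refine .of_path_lifting_section ⟨fun t ↦ ⟨g t, hmem t⟩, by fun_prop⟩ (fun x ↦ τ (p x))
    (fun x ↦ Subtype.ext ((hp.mem_pathComponent_iff hfτ hτ hg he).1 x.2)) fun q ↦ ?_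
  exact hτ ⟨fun t ↦ p (q t), hp.continuous.comp (continuous_subtype_val.comp q.continuous)⟩

/-- A two-fold covering of a space all of whose paths reparametrize a single curve has exactly two
path components, both of them simply connected. -/
theorem IsCoveringMap.exists_two_pathComponents (hp : IsCoveringMap p) [Nonempty W]
    (hcard : ∀ b : W, Nat.card (p ⁻¹' {b}) = 2) (hfτ : ∀ w, f (τ w) = w)
    (hτ : ∀ q : C(I, W), Continuous (τ ∘ q)) :
    ∃ C₁ C₂ : Set E, C₁ ≠ C₂ ∧ (∀ x : E, pathComponent x = C₁ ∨ pathComponent x = C₂) ∧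
      (∃ x : E, pathComponent x = C₁) ∧ (∃ x : E, pathComponent x = C₂) ∧
      SimplyConnectedSpace C₁ ∧ SimplyConnectedSpace C₂ := by
  obtain ⟨w⟩ := ‹Nonempty W›
  obtain ⟨⟨e₁, h₁⟩, ⟨e₂, h₂⟩, hne, -⟩ := Nat.card_eq_two_iff.1 (hcard w)
  simp only [mem_preimage, mem_singleton_iff] at h₁ h₂
  have hne : e₁ ≠ e₂ := fun h ↦ hne (Subtype.ext h)
  have lift (e : E) (he : p e = w) : ∃ g : C(ℝ, E), g (τ w) = e ∧ p ∘ g = f :=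
    (hp.existsUnique_continuousMap_lifts f (τ w) e (by rw [he, hfτ])).exists
  obtain ⟨g₁, hg₁, hpg₁⟩ := lift e₁ h₁
  obtain ⟨g₂, hg₂, hpg₂⟩ := lift e₂ h₂
  have he₁ : g₁ (τ (p e₁)) = e₁ := by rw [h₁, hg₁]
  have he₂ : g₂ (τ (p e₂)) = e₂ := by rw [h₂, hg₂]
  refine ⟨pathComponent e₁, pathComponent e₂, fun h ↦ ?_, fun x ↦ ?_, ⟨e₁, rfl⟩, ⟨e₂, rfl⟩,
    hp.simplyConnectedSpace_pathComponent hfτ hτ hpg₁ he₁,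
    hp.simplyConnectedSpace_pathComponent hfτ hτ hpg₂ he₂⟩
  · have h' : e₂ ∈ pathComponent e₁ := h ▸ mem_pathComponent_self e₂
    rw [hp.mem_pathComponent_iff hfτ hτ hpg₁ he₁, h₂, hg₁] at h'
    exact hne h'
  · have hx (g : C(ℝ, E)) (hg : p ∘ g = f) : p (g (τ (p x))) = p x :=
      (congr_fun hg _).trans (hfτ _)
    have hdiff : g₁ (τ (p x)) ≠ g₂ (τ (p x)) := fun h ↦ hne <| by
      rw [← hg₁, ← hg₂]
      exact congr_fun (hp.eq_of_comp_eq g₁.continuous g₂.continuous (hpg₁.trans hpg₂.symm) _ h) _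
    have hfib := (Nat.card_eq_two_iff' (⟨x, rfl⟩ : p ⁻¹' {p x})).1 (hcard (p x))
    have : g₁ (τ (p x)) = x ∨ g₂ (τ (p x)) = x := by
      by_contra! hcon
      refine hdiff (congr_arg Subtype.val (hfib.unique (y₁ := ⟨g₁ (τ (p x)), hx g₁ hpg₁⟩)
        (y₂ := ⟨g₂ (τ (p x)), hx g₂ hpg₂⟩) ?_ ?_))
      · simpa [Subtype.ext_iff] using hcon.1
      · simpa [Subtype.ext_iff] using hcon.2
    refine this.imp (fun h ↦ ?_) fun h ↦ ?_
    · exact pathComponent_congr ((hp.mem_pathComponent_iff hfτ hτ hpg₁ he₁).2 h)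
    · exact pathComponent_congr ((hp.mem_pathComponent_iff hfτ hτ hpg₂ he₂).2 h)

end Lifts

/-- A curve sweeping out the Warsaw Circle: it is constantly `(0, 1)` up to time `-3`, runs down
the vertical segment and along the arc until time `3`, and then follows the graph towards the
segment forever. -/
noncomputable def warsawCurve (t : ℝ) : ℝ × ℝ :=
  (max 0 (min t 1) / max 1 (t - 2),
    max (-2 - max t (-3)) (-2) + min (max 0 (t - 1)) 2 + Real.sin (max 1 (t - 2) * π))

theorem continuous_warsawCurve : Continuous warsawCurve := by
  unfold warsawCurve
  refine .prodMk (.div (by fun_prop) (by fun_prop) fun t ↦ ?_) (by fun_prop)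
  exact (zero_lt_one.trans_le (le_max_left _ _)).ne'

theorem warsawCurve_of_le {t : ℝ} (ht : t ≤ -3) : warsawCurve t = (0, 1) := by
  unfold warsawCurve
  rw [max_eq_left (a := 1) (by linarith), min_eq_left (by linarith : t ≤ 1),
    max_eq_left (by linarith : t ≤ 0), max_eq_right ht, max_eq_left (by norm_num),
    max_eq_left (by linarith : t - 1 ≤ 0), min_eq_left (by norm_num)]
  norm_num

theorem warsawCurve_segment {t : ℝ} (h₁ : -3 ≤ t) (h₂ : t ≤ 0) :
    warsawCurve t = (0, -2 - t) := by
  unfold warsawCurve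
  rw [max_eq_left (a := 1) (by linarith), min_eq_left (by linarith : t ≤ 1),
    max_eq_left (by linarith : t ≤ 0), max_eq_left h₁, max_eq_left (by linarith),
    max_eq_left (by linarith : t - 1 ≤ 0), min_eq_left (by norm_num)]
  norm_num

theorem warsawCurve_bottom {t : ℝ} (h₁ : 0 ≤ t) (h₂ : t ≤ 1) :
    warsawCurve t = (t, -2) := by
  unfold warsawCurve
  rw [max_eq_left (a := 1) (by linarith), min_eq_left (by linarith : t ≤ 1),
    max_eq_right h₁, max_eq_left (by linarith : -3 ≤ t), max_eq_right (by linarith),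
    max_eq_left (by linarith : t - 1 ≤ 0), min_eq_left (by norm_num)]
  norm_num

theorem warsawCurve_right {t : ℝ} (h₁ : 1 ≤ t) (h₂ : t ≤ 3) :
    warsawCurve t = (1, t - 3) := by
  unfold warsawCurve
  rw [max_eq_left (a := 1) (by linarith), min_eq_right (by linarith : 1 ≤ t),
    max_eq_right zero_le_one, max_eq_left (by linarith : -3 ≤ t), max_eq_right (by linarith),
    max_eq_right (by linarith : 0 ≤ t - 1), min_eq_left (by linarith)]
  norm_num
  ring

theorem warsawCurve_graph {t : ℝ} (h : 3 ≤ t) :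
    warsawCurve t = (1 / (t - 2), Real.sin ((t - 2) * π)) := by
  unfold warsawCurve
  rw [max_eq_right (a := 1) (by linarith), min_eq_right (by linarith : 1 ≤ t),
    max_eq_right zero_le_one, max_eq_left (by linarith : -3 ≤ t), max_eq_right (by linarith),
    max_eq_right (by linarith : 0 ≤ t - 1), min_eq_right (by linarith)]
  norm_num

theorem warsawCurve_mem (t : ℝ) : warsawCurve t ∈ WarsawCircle := by
  rcases le_total t (-3) with h₁ | h₁
  · rw [warsawCurve_of_le h₁]
    exact .inl (.inr (by simp))
  rcases le_total t 0 with h₂ | h₂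
  · rw [warsawCurve_segment h₁ h₂]
    rcases le_total t (-1) with h | h
    · exact .inl (.inr ⟨rfl, by constructor <;> simp only <;> linarith⟩)
    · exact .inr (.inr ⟨rfl, by constructor <;> simp only <;> linarith⟩)
  rcases le_total t 1 with h₃ | h₃
  · rw [warsawCurve_bottom h₂ h₃]
    exact .inr (.inl (.inr ⟨⟨h₂, h₃⟩, rfl⟩))
  rcases le_total t 3 with h₄ | h₄
  · rw [warsawCurve_right h₃ h₄]
    exact .inr (.inl (.inl ⟨rfl, by constructor <;> simp only <;> linarith⟩))
  · rw [warsawCurve_graph h₄]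
    refine .inl (.inl ⟨1 / (t - 2), by apply one_div_pos.2; linarith, ?_, ?_⟩)
    · rw [div_le_one (by linarith)]
      linarith
    · rw [div_div_eq_mul_div, div_one, mul_comm]

theorem exists_warsawCurve_eq {w : ℝ × ℝ} (hw : w ∈ WarsawCircle) :
    ∃ t, -3 ≤ t ∧ warsawCurve t = w := by
  obtain ⟨x, y⟩ := w
  rcases hw with (⟨x, h₀, h₁, h⟩ | ⟨hx, hy⟩) | (⟨hx, hy⟩ | ⟨hx, hy⟩) | ⟨hx, hy⟩
  · have : 1 ≤ 1 / x := by rwa [le_div_iff₀ h₀, one_mul]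
    refine ⟨2 + 1 / x, by linarith, ?_⟩
    rw [warsawCurve_graph (by linarith), h]
    simp [div_eq_mul_inv, mul_comm]
  · simp only [mem_singleton_iff, mem_Icc] at hx hy
    refine ⟨-2 - y, by linarith, ?_⟩
    rw [warsawCurve_segment (by linarith) (by linarith), hx]
    simp
  · simp only [mem_singleton_iff, mem_Icc] at hx hy
    refine ⟨3 + y, by linarith, ?_⟩
    rw [warsawCurve_right (by linarith) (by linarith), hx]
    simp
  · simp only [mem_singleton_iff, mem_Icc] at hx hy
    refine ⟨x, by linarith, ?_⟩
    rw [warsawCurve_bottom (by linarith) (by linarith), hy]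
  · simp only [mem_singleton_iff, mem_Icc] at hx hy
    refine ⟨-2 - y, by linarith, ?_⟩
    rw [warsawCurve_segment (by linarith) (by linarith), hx]
    simp

theorem injOn_warsawCurve : InjOn warsawCurve (Ici (-3)) := by
  have key {s t : ℝ} (hs : -3 ≤ s) (hst : s < t) : warsawCurve s ≠ warsawCurve t := by
    intro h
    rcases le_or_gt t 0 with ht₁ | ht₁
    · rw [warsawCurve_segment hs (by linarith), warsawCurve_segment (by linarith) ht₁,
        Prod.mk.injEq] at h
      linarith
    rcases le_or_gt t 1 with ht₂ | ht₂
    · rw [warsawCurve_bottom ht₁.le ht₂] at h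
      rcases le_or_gt s 0 with hs₁ | hs₁
      · rw [warsawCurve_segment hs hs₁, Prod.mk.injEq] at h
        linarith
      · rw [warsawCurve_bottom hs₁.le (by linarith), Prod.mk.injEq] at h
        linarith
    rcases le_or_gt t 3 with ht₃ | ht₃
    · rw [warsawCurve_right ht₂.le ht₃] at h
      rcases le_or_gt s 0 with hs₁ | hs₁
      · rw [warsawCurve_segment hs hs₁, Prod.mk.injEq] at h
        linarith
      rcases le_or_gt s 1 with hs₂ | hs₂
      · rw [warsawCurve_bottom hs₁.le hs₂, Prod.mk.injEq] at h
        linarith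
      · rw [warsawCurve_right hs₂.le (by linarith), Prod.mk.injEq] at h
        linarith
    · rw [warsawCurve_graph ht₃.le] at h
      have h₀ : 0 < 1 / (t - 2) := by apply one_div_pos.2; linarith
      have h₁ : 1 / (t - 2) < 1 := by rw [div_lt_one (by linarith)]; linarith
      have h₂ := neg_one_le_sin ((t - 2) * π)
      rcases le_or_gt s 0 with hs₁ | hs₁
      · rw [warsawCurve_segment hs hs₁, Prod.mk.injEq] at h
        linarith
      rcases le_or_gt s 1 with hs₂ | hs₂
      · rw [warsawCurve_bottom hs₁.le hs₂, Prod.mk.injEq] at h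
        linarith
      rcases le_or_gt s 3 with hs₃ | hs₃
      · rw [warsawCurve_right hs₂.le hs₃, Prod.mk.injEq] at h
        linarith
      · rw [warsawCurve_graph hs₃.le, Prod.mk.injEq] at h
        have := one_div_lt_one_div_of_lt (by linarith : 0 < s - 2) (by linarith : s - 2 < t - 2)
        linarith
  intro s hs t ht h
  rcases lt_trichotomy s t with hst | hst | hst
  · exact absurd h (key hs hst)
  · exact hst
  · exact absurd h.symm (key ht hst)

theorem warsawCurve_snd_of_fst_eq {t n : ℝ} (hn : 1 < n) (h : (warsawCurve t).1 = 1 / n) :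
    (warsawCurve t).2 = -2 ∨ (warsawCurve t).2 = Real.sin (n * π) := by
  have h₀ : 0 < 1 / n := by positivity
  have h₁ : 1 / n < 1 := by rw [div_lt_one (by linarith)]; linarith
  rcases le_total t (-3) with ht₁ | ht₁
  · rw [warsawCurve_of_le ht₁] at h
    exact absurd h h₀.ne
  rcases le_total t 0 with ht₂ | ht₂
  · rw [warsawCurve_segment ht₁ ht₂] at h
    exact absurd h h₀.ne
  rcases le_total t 1 with ht₃ | ht₃
  · rw [warsawCurve_bottom ht₂ ht₃]
    exact .inl rfl
  rcases le_total t 3 with ht₄ | ht₄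
  · rw [warsawCurve_right ht₃ ht₄] at h
    exact absurd h h₁.ne'
  · rw [warsawCurve_graph ht₄] at h ⊢
    have : t - 2 = n := by simpa using h
    exact .inr (by rw [this])

theorem exists_large_sin_eq (M : ℝ) :
    (∃ n : ℝ, M < n ∧ Real.sin (n * π) = 1) ∧ ∃ n : ℝ, M < n ∧ Real.sin (n * π) = -1 := by
  obtain ⟨k, hk⟩ := exists_nat_gt M
  have hk₀ : (0 : ℝ) ≤ k := k.cast_nonneg
  refine ⟨⟨k * 2 + 1 / 2, by linarith, ?_⟩, ⟨((k + 1 : ℕ) : ℝ) * 2 - 1 / 2, ?_, ?_⟩⟩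
  · rw [show (k * 2 + 1 / 2 : ℝ) * π = π / 2 + k * (2 * π) by ring, sin_add_nat_mul_two_pi,
      sin_pi_div_two]
  · push_cast
    linarith
  · rw [show (((k + 1 : ℕ) : ℝ) * 2 - 1 / 2 : ℝ) * π = -(π / 2) + (k + 1 : ℕ) * (2 * π) by ring,
      sin_add_nat_mul_two_pi, sin_neg, sin_pi_div_two]

/-- A connected set of parameters whose image stays near a point with vanishing first coordinate
does not reach the graph. -/
theorem le_three_of_isPreconnected {s : Set (ℝ × ℝ)} (hs : IsPreconnected s) {y : ℝ}
    (h₀ : (0, y) ∈ s) (hy : ∀ w ∈ s, |w.2 - y| < 1 / 2) (hW : s ⊆ range warsawCurve)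
    {t : ℝ} (ht : warsawCurve t ∈ s) : t ≤ 3 := by
  by_contra! h
  have ht' := hy _ ht
  have hsub : Icc 0 (1 / (t - 2)) ⊆ Prod.fst '' s := by
    refine (hs.image _ continuous_fst.continuousOn).Icc_subset ⟨_, h₀, rfl⟩ ⟨_, ht, ?_⟩
    rw [warsawCurve_graph h.le]
  have key {n : ℝ} (hn : t - 2 < n) : |-2 - y| < 1 / 2 ∨ |Real.sin (n * π) - y| < 1 / 2 := by
    obtain ⟨w, hw, hwn⟩ := hsub ⟨by apply one_div_nonneg.2; linarith,
      (one_div_le_one_div_of_le (by linarith) hn.le : 1 / n ≤ _)⟩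
    obtain ⟨u, rfl⟩ := hW hw
    have := hy _ hw
    rcases warsawCurve_snd_of_fst_eq (by linarith) hwn with h | h
    · exact .inl (h ▸ this)
    · exact .inr (h ▸ this)
  rw [warsawCurve_graph h.le] at ht'
  have hsin := neg_one_le_sin ((t - 2) * π)
  obtain ⟨⟨m, hm, hm₁⟩, n, hn, hn₁⟩ := exists_large_sin_eq (t - 2)
  have h₁ := key hm
  have h₂ := key hn
  rw [hm₁] at h₁
  rw [hn₁] at h₂
  simp only [abs_lt] at h₁ h₂ ht'
  rcases h₁ with h₁ | h₁ <;> rcases h₂ with h₂ | h₂ <;> linarith [h₁.1, h₁.2, h₂.1, h₂.2, ht'.2]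

theorem continuous_of_continuous_warsawCurve_comp {X : Type*} [TopologicalSpace X]
    [LocallyConnectedSpace X] {r : X → ℝ} (hr : ∀ x, -3 ≤ r x)
    (h : Continuous fun x ↦ warsawCurve (r x)) : Continuous r := by
  rw [continuous_iff_continuousAt]
  intro x
  obtain ⟨T, hT⟩ : ∃ T, ∀ᶠ u in 𝓝 x, r u ≤ T := by
    by_cases hx : 0 < (warsawCurve (r x)).1
    · obtain ⟨δ, hδ, hδx⟩ := exists_between hx
      refine ⟨3 + 1 / δ, ?_⟩
      filter_upwards [h.fst.continuousAt.eventually (lt_mem_nhds hδx)] with u hu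
      by_contra! hcon
      have : 0 < 1 / δ := by positivity
      rw [warsawCurve_graph (by linarith)] at hu
      have := (lt_one_div hδ (by linarith)).1 hu
      linarith
    · have hx₀ : (warsawCurve (r x)).1 = 0 :=
        le_antisymm (not_lt.1 hx) (div_nonneg (by simp) (by simp))
      set F := (fun u ↦ warsawCurve (r u)) ⁻¹' {w | |w.2 - (warsawCurve (r x)).2| < 1 / 2}
      have hF : F ∈ 𝓝 x := by
        refine h.continuousAt.preimage_mem_nhds (IsOpen.mem_nhds ?_ (by simp))
        exact isOpen_lt (by fun_prop) continuous_const
      refine ⟨3, ?_⟩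
      filter_upwards [connectedComponentIn_mem_nhds hF] with u hu
      refine le_three_of_isPreconnected (y := (warsawCurve (r x)).2)
        (isPreconnected_connectedComponentIn.image _ h.continuousOn)
        ⟨x, mem_connectedComponentIn (mem_of_mem_nhds hF), by rw [← hx₀]⟩ ?_ ?_ ⟨u, hu, rfl⟩
      · rintro _ ⟨v, hv, rfl⟩
        have hvF : v ∈ F := connectedComponentIn_subset F x hv
        exact hvF
      · rintro _ ⟨v, -, rfl⟩
        exact ⟨_, rfl⟩
  refine isCompact_Icc.tendsto_nhds_of_unique_mapClusterPt (s := Icc (-3) T)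
    (hT.mono fun u hu ↦ ⟨hr u, hu⟩) fun t ht hcl ↦ injOn_warsawCurve ht.1 (hr x) ?_
  have := hcl.continuousAt_comp continuous_warsawCurve.continuousAt
  exact eq_of_nhds_neBot (ClusterPt.mono this (h.tendsto x))

theorem Complex.sqrt_pow_two (z : ℂ) : z.sqrt ^ 2 = z := by
  simp [Complex.sqrt, ← Complex.cpow_nat_mul]

theorem Complex.I_mul_sqrt_neg_of_im_pos {z : ℂ} (hz : 0 < z.im) :
    Complex.I * (-z).sqrt = z.sqrt := by
  have h₀ : z ≠ 0 := by
    rintro rfl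
    simp at hz
  have hlog : Complex.log (-z) = Complex.log z - (π : ℝ) * Complex.I := by
    apply Complex.ext <;> simp [log_re, log_im, arg_neg_eq_arg_sub_pi_of_im_pos hz]
  have hexp : Complex.log (-z) * 2⁻¹ = Complex.log z * 2⁻¹ - (π : ℝ) / 2 * Complex.I := by
    rw [hlog]
    ring
  simp only [Complex.sqrt]
  rw [cpow_def_of_ne_zero (neg_ne_zero.2 h₀), cpow_def_of_ne_zero h₀, hexp, Complex.exp_sub,
    exp_pi_div_two_mul_I]
  field_simp

theorem Complex.I_mul_sqrt_neg_of_im_neg {z : ℂ} (hz : z.im < 0) :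
    Complex.I * (-z).sqrt = -z.sqrt := by
  have h := I_mul_sqrt_neg_of_im_pos (z := -z) (by simpa using hz)
  rw [neg_neg] at h
  rw [← h, ← mul_assoc, I_mul_I, neg_one_mul]

/-- Coordinates on the plane, centred at a point enclosed by the Warsaw Circle and rotated so that
the negative real axis crosses only the graph. -/
noncomputable def warsawChart : ℂ ≃ₜ ℝ × ℝ where
  toFun z := (z.im + 1 / 2, -z.re - 3 / 2)
  invFun w := ⟨-w.2 - 3 / 2, w.1 - 1 / 2⟩
  left_inv z := by
    apply Complex.ext <;> simp
  right_inv w := by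
    ext <;> simp
  continuous_toFun := by fun_prop
  continuous_invFun := by
    have : Continuous fun w : ℝ × ℝ ↦
        Complex.equivRealProdCLM.symm (-w.2 - 3 / 2, w.1 - 1 / 2) := by
      fun_prop
    exact this

theorem warsawChart_symm_apply (w : ℝ × ℝ) :
    warsawChart.symm w = ⟨-w.2 - 3 / 2, w.1 - 1 / 2⟩ := rfl

theorem warsawChart_zero_notMem : warsawChart 0 ∉ WarsawCircle := by
  have h : warsawChart 0 = (1 / 2, -(3 / 2)) := by
    simp [warsawChart]
  rw [h]
  rintro ((⟨x, -, -, hx⟩ | ⟨hx, -⟩) | (⟨hx, -⟩ | ⟨-, hy⟩) | ⟨hx, -⟩)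
  · have := (Prod.mk.inj hx).2
    linarith [neg_one_le_sin (π / x)]
  all_goals norm_num at *

/-- The squaring map in the coordinates `warsawChart`. -/
noncomputable def warsawSquare (z : ℂ) : ℝ × ℝ := warsawChart (z ^ 2)

theorem isCoveringMapOn_warsawSquare : IsCoveringMapOn warsawSquare WarsawCircle := by
  refine ((isCoveringMapOn_npow (𝕜 := ℂ) 2 (by norm_num)).homeomorph_comp warsawChart).mono ?_
  rintro w hw (h : warsawChart.symm w = 0)
  rw [Homeomorph.symm_apply_eq] at h
  exact warsawChart_zero_notMem (h ▸ hw)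

theorem warsawSquare_eq_iff {z z' : ℂ} : warsawSquare z = warsawSquare z' ↔ z = z' ∨ z = -z' := by
  simp [warsawSquare, sq_eq_sq_iff_eq_or_eq_neg]

theorem exists_warsawSquare_eq (w : ℝ × ℝ) : ∃ z, warsawSquare z = w := by
  refine ⟨(warsawChart.symm w).sqrt, ?_⟩
  rw [warsawSquare, Complex.sqrt_pow_two, Homeomorph.apply_symm_apply]

theorem card_fiber_warsawSquare (b : WarsawCircle) :
    Nat.card (WarsawCircle.restrictPreimage warsawSquare ⁻¹' {b}) = 2 := by
  obtain ⟨z, hz⟩ := exists_warsawSquare_eq b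
  have hz₀ : z ≠ 0 := by
    rintro rfl
    rw [warsawSquare, zero_pow two_ne_zero] at hz
    exact warsawChart_zero_notMem (hz ▸ b.2)
  have hz' : warsawSquare (-z) = b := (warsawSquare_eq_iff.2 (.inr rfl)).trans hz
  have hmem {y : ℂ} (hy : warsawSquare y = b) : y ∈ warsawSquare ⁻¹' WarsawCircle := by
    rw [mem_preimage, hy]
    exact b.2
  refine Nat.card_eq_two_iff.2 ⟨⟨⟨z, hmem hz⟩, Subtype.ext hz⟩, ⟨⟨-z, hmem hz'⟩, Subtype.ext hz'⟩,
    ?_, ?_⟩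
  · simpa [Subtype.ext_iff] using self_eq_neg.not.2 hz₀
  · refine eq_univ_of_forall fun ⟨⟨y, hy⟩, hyb⟩ ↦ ?_
    have : warsawSquare y = warsawSquare z := (congr_arg Subtype.val hyb).trans hz.symm
    simpa [Subtype.ext_iff] using warsawSquare_eq_iff.1 this

theorem isPreconnected_preimage_warsawSquare :
    IsPreconnected (warsawSquare ⁻¹' WarsawCircle) := by
  set ζ : ℝ → ℂ := fun t ↦ warsawChart.symm (warsawCurve t) with hζ
  have hζc : Continuous ζ := warsawChart.symm.continuous.comp continuous_warsawCurve
  set B : Set ℂ := (fun t ↦ (ζ t).sqrt) '' Icc (-3) 3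
  set A : Set ℂ := (fun t ↦ Complex.I * (-ζ t).sqrt) '' Ici 3
  have hζ₃ : ζ 3 = ⟨-3 / 2, 1 / 2⟩ := by
    simp only [hζ, warsawCurve_right (by norm_num : (1 : ℝ) ≤ 3) le_rfl, warsawChart_symm_apply]
    norm_num
  have hζ₀ : ζ (-3) = ⟨-5 / 2, -1 / 2⟩ := by
    simp only [hζ, warsawCurve_of_le le_rfl, warsawChart_symm_apply]
    norm_num
  have hB : IsPreconnected B := by
    refine isPreconnected_Icc.image _ fun t ht ↦ ContinuousAt.continuousWithinAt ?_
    refine ContinuousAt.comp (Complex.hasDerivAt_sqrt ?_).continuousAt hζc.continuousAt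
    simp only [hζ, warsawChart_symm_apply, Complex.mem_slitPlane_iff]
    rcases le_total t 0 with h₁ | h₁
    · rw [warsawCurve_segment ht.1 h₁]
      norm_num
    rcases le_total t 1 with h₂ | h₂
    · rw [warsawCurve_bottom h₁ h₂]
      norm_num
    · rw [warsawCurve_right h₂ ht.2]
      norm_num
  have hA : IsPreconnected A := by
    refine isPreconnected_Ici.image _ fun t ht ↦ ContinuousAt.continuousWithinAt ?_
    refine continuousAt_const.mul (ContinuousAt.comp (g := Complex.sqrt)
      (Complex.hasDerivAt_sqrt ?_).continuousAt hζc.neg.continuousAt)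
    simp only [hζ, warsawChart_symm_apply, Complex.mem_slitPlane_iff, warsawCurve_graph ht]
    refine .inl ?_
    simp only [Complex.neg_re]
    linarith [neg_one_le_sin ((t - 2) * π)]
  have hT : IsPreconnected (B ∪ A) :=
    hB.union (ζ 3).sqrt ⟨3, by norm_num, rfl⟩
      ⟨3, self_mem_Ici, Complex.I_mul_sqrt_neg_of_im_pos (z := ζ 3) (by rw [hζ₃]; norm_num)⟩ hA
  have hlim : -(ζ (-3)).sqrt ∈ closure (B ∪ A) := by
    choose n hn hsin using fun k : ℕ ↦ (exists_large_sin_eq (k + 1)).1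
    have hn₁ (k : ℕ) : 3 ≤ n k + 2 := by
      have := hn k
      linarith [(k.cast_nonneg : (0 : ℝ) ≤ k)]
    have hn_top : Tendsto n atTop atTop :=
      tendsto_atTop_mono (fun k ↦ by linarith [hn k]) tendsto_natCast_atTop_atTop
    have hcurve : Tendsto (fun k ↦ warsawCurve (n k + 2)) atTop (𝓝 (warsawCurve (-3))) := by
      simp only [warsawCurve_graph (hn₁ _), warsawCurve_of_le le_rfl, add_sub_cancel_right, hsin,
        one_div]
      exact (tendsto_inv_atTop_zero.comp hn_top).prodMk_nhds tendsto_const_nhds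
    have hζ_lim : Tendsto (fun k ↦ ζ (n k + 2)) atTop (𝓝 (ζ (-3))) :=
      (warsawChart.symm.continuous.tendsto _).comp hcurve
    rw [← Complex.I_mul_sqrt_neg_of_im_neg (z := ζ (-3)) (by rw [hζ₀]; norm_num)]
    have hsqrt : ContinuousAt Complex.sqrt (-ζ (-3)) := by
      refine (Complex.hasDerivAt_sqrt ?_).continuousAt
      rw [hζ₀, Complex.mem_slitPlane_iff]
      norm_num
    exact mem_closure_of_tendsto ((hsqrt.tendsto.comp hζ_lim.neg).const_mul Complex.I)
      (.of_forall fun k ↦ .inr ⟨n k + 2, hn₁ k, rfl⟩)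
  have hunion : warsawSquare ⁻¹' WarsawCircle = insert (-(ζ (-3)).sqrt) (B ∪ A) ∪ -(B ∪ A) := by
    have hζ_mem {z : ℂ} {t : ℝ} (hz : z ^ 2 = ζ t) : z ∈ warsawSquare ⁻¹' WarsawCircle := by
      rw [mem_preimage, warsawSquare, hz, Homeomorph.apply_symm_apply]
      exact warsawCurve_mem t
    have hA_sq (t : ℝ) : (Complex.I * (-ζ t).sqrt) ^ 2 = ζ t := by
      rw [mul_pow, Complex.sqrt_pow_two, Complex.I_sq, neg_one_mul, neg_neg]
    have hBA_sq {z : ℂ} (hz : z ∈ B ∪ A) : ∃ t, z ^ 2 = ζ t := by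
      rcases hz with ⟨t, -, rfl⟩ | ⟨t, -, rfl⟩
      · exact ⟨t, Complex.sqrt_pow_two _⟩
      · exact ⟨t, hA_sq t⟩
    ext z
    constructor
    · intro hz
      obtain ⟨t, ht, htz⟩ := exists_warsawCurve_eq hz
      have hz_sq : z ^ 2 = ζ t := by
        simp only [hζ]
        rw [htz, warsawSquare, Homeomorph.symm_apply_apply]
      obtain ⟨y, hy, hzy⟩ : ∃ y ∈ B ∪ A, z ^ 2 = y ^ 2 := by
        rcases le_total t 3 with h | h
        · exact ⟨_, .inl ⟨t, ⟨ht, h⟩, rfl⟩, hz_sq.trans (Complex.sqrt_pow_two _).symm⟩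
        · exact ⟨_, .inr ⟨t, h, rfl⟩, hz_sq.trans (hA_sq t).symm⟩
      rcases sq_eq_sq_iff_eq_or_eq_neg.1 hzy with rfl | rfl
      · exact .inl (.inr hy)
      · exact .inr (by rwa [Set.mem_neg, neg_neg])
    · rintro ((rfl | hz) | hz)
      · exact hζ_mem (t := -3) (by rw [neg_sq, Complex.sqrt_pow_two])
      · exact hζ_mem (hBA_sq hz).choose_spec
      · refine hζ_mem (t := (hBA_sq hz).choose) ?_
        rw [← neg_sq]
        exact (hBA_sq hz).choose_spec
  rw [hunion]
  refine (hT.subset_closure (subset_insert _ _) (insert_subset hlim subset_closure)).union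
    (-(ζ (-3)).sqrt) (mem_insert _ _) ?_ ?_
  · rw [Set.mem_neg, neg_neg]
    exact .inl ⟨-3, by norm_num, rfl⟩
  · rw [← image_neg_eq_neg]
    exact hT.image _ continuous_neg.continuousOn

/-- There is a two-fold covering `p : E → W` of the Warsaw Circle with `E` connected but
not path-connected; moreover `E` has exactly two path components, each simply connected. -/
theorem exists_anomalous_covering_of_warsawCircle :
    ∃ (E : TopCat) (p : E → WarsawCircle), IsCoveringMap p ∧ Function.Surjective p ∧
      (∀ b : WarsawCircle, Nat.card (p ⁻¹' {b}) = 2) ∧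
      ConnectedSpace E ∧ ¬ PathConnectedSpace E ∧
      ∃ C₁ C₂ : Set E, C₁ ≠ C₂ ∧ (∀ x : E, pathComponent x = C₁ ∨ pathComponent x = C₂) ∧
        (∃ x : E, pathComponent x = C₁) ∧ (∃ x : E, pathComponent x = C₂) ∧
        SimplyConnectedSpace C₁ ∧ SimplyConnectedSpace C₂ := by
  choose τ hτ₃ hτ using fun w : WarsawCircle ↦ exists_warsawCurve_eq w.2
  have hτc (q : C(I, WarsawCircle)) : Continuous (τ ∘ q) := by
    have : Continuous fun s : ℝ ↦ τ (q (projIcc 0 1 zero_le_one s)) := by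
      refine continuous_of_continuous_warsawCurve_comp (fun _ ↦ hτ₃ _) ?_
      simp only [hτ]
      exact continuous_subtype_val.comp (q.continuous.comp continuous_projIcc)
    exact (this.comp continuous_subtype_val).congr fun x ↦
      congr_arg (fun y ↦ τ (q y)) (projIcc_val zero_le_one x)
  have : Nonempty WarsawCircle := ⟨⟨_, warsawCurve_mem 0⟩⟩
  let p : ULift (warsawSquare ⁻¹' WarsawCircle) → WarsawCircle :=
    WarsawCircle.restrictPreimage warsawSquare ∘ Homeomorph.ulift
  have hp : IsCoveringMap p :=
    isCoveringMapOn_warsawSquare.isCoveringMap_restrictPreimage.comp_homeomorph _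
  have hcard (b : WarsawCircle) : Nat.card (p ⁻¹' {b}) = 2 := by
    rw [← card_fiber_warsawSquare b]
    exact Nat.card_congr (Equiv.ulift.subtypeEquiv fun _ ↦ Iff.rfl)
  obtain ⟨C₁, C₂, hne, h⟩ := hp.exists_two_pathComponents hcard
    (f := ⟨fun t ↦ ⟨warsawCurve t, warsawCurve_mem t⟩, continuous_warsawCurve.subtype_mk _⟩)
    (fun w ↦ Subtype.ext (hτ w)) hτc
  obtain ⟨x, hx⟩ := h.2.1
  have : ConnectedSpace (warsawSquare ⁻¹' WarsawCircle) :=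
    isConnected_iff_connectedSpace.1 ⟨⟨_, x.down.2⟩, isPreconnected_preimage_warsawSquare⟩
  refine ⟨TopCat.of (ULift (warsawSquare ⁻¹' WarsawCircle)), p, hp, fun b ↦ ?_, hcard,
    Homeomorph.ulift.symm.surjective.connectedSpace Homeomorph.ulift.symm.continuous,
    fun hE ↦ hne ?_, C₁, C₂, hne, h⟩
  · obtain ⟨z, hz⟩ := exists_warsawSquare_eq b
    exact ⟨⟨z, by rw [mem_preimage, hz]; exact b.2⟩, Subtype.ext hz⟩
  · obtain ⟨y, hy⟩ := h.2.2.1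
    rw [← hx, ← hy]
    exact pathComponent_congr (hE.joined y x)
end

section
/- There exist nonempty connected topological spaces E and B with B path-connected and simply connected, and a covering map p : E → B every fiber of which has exactly two elements; in particular p is not injective, so a simply connected space can admit a connected covering that is not a homeomorphism. -/
open Filter Topology Set

/-- The real line with the coarser topology in which the sequence of natural numbers
also converges to `0`. -/
structure PinchedLine where
  /-- The underlying real number. -/
  val : ℝ

/-- Two copies of the real line, indexed by `ZMod 2`, with the coarser topology in which the
natural numbers of each copy also converge to the origin of the other copy. -/
@[ext]
structure PinchedDouble where
  /-- The underlying real number. -/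
  val : ℝ
  /-- The index of the copy of the line. -/
  sheet : ZMod 2

namespace PinchedLine

instance : TopologicalSpace PinchedLine where
  IsOpen U := IsOpen (mk ⁻¹' U) ∧ (mk 0 ∈ U → ∀ᶠ n : ℕ in atTop, mk n ∈ U)
  isOpen_univ := by simp
  isOpen_inter U V hU hV :=
    ⟨hU.1.inter hV.1, fun h => (hU.2 h.1).and (hV.2 h.2)⟩
  isOpen_sUnion S hS := by
    refine ⟨?_, ?_⟩
    · rw [preimage_sUnion]
      exact isOpen_biUnion fun U hU => (hS U hU).1
    · rintro ⟨U, hU, h0⟩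
      exact ((hS U hU).2 h0).mono fun n hn => ⟨U, hU, hn⟩

theorem isOpen_iff {U : Set PinchedLine} :
    IsOpen U ↔ IsOpen (mk ⁻¹' U) ∧ (mk 0 ∈ U → ∀ᶠ n : ℕ in atTop, mk n ∈ U) :=
  Iff.rfl

theorem continuous_mk : Continuous mk :=
  continuous_def.2 fun _ hU => hU.1

theorem isOpen_preimage_val {s : Set ℝ} (hs : IsOpen s)
    (h : (0 : ℝ) ∈ s → ∀ᶠ n : ℕ in atTop, (n : ℝ) ∈ s) :
    IsOpen (val ⁻¹' s) :=
  isOpen_iff.2 ⟨hs, h⟩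

/-- A connected subset of a small neighborhood of `0` that contains `0` cannot reach the
natural numbers. -/
theorem abs_val_lt_of_isPreconnected {C : Set PinchedLine} (hC : IsPreconnected C)
    (h0 : mk 0 ∈ C) {ε : ℝ} (hε : 0 < ε) (hε' : ε ≤ 1 / 2)
    (hsub : ∀ x ∈ C, |x.val| < ε ∨ ∃ n : ℕ, 0 < n ∧ |x.val - n| < 1 / 2) :
    ∀ x ∈ C, |x.val| < ε := by
  intro x hx
  refine (hsub x hx).resolve_right ?_
  rintro ⟨n, hn, hxn⟩
  have hn1 : (1 : ℝ) ≤ n := by exact_mod_cast hn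
  let u : Set ℝ := {t | |t| < ε} ∪ ⋃ m ∈ {m : ℕ | 0 < m ∧ m ≠ n}, {t : ℝ | |t - m| < 1 / 2}
  let v : Set ℝ := {t | |t - n| < 1 / 2}
  have hu : IsOpen u :=
    (isOpen_lt (by fun_prop) (by fun_prop)).union
      (isOpen_biUnion fun m _ => isOpen_lt (by fun_prop) (by fun_prop))
  have hv : IsOpen v := isOpen_lt (by fun_prop) (by fun_prop)
  have huv : Disjoint u v := by
    rw [Set.disjoint_left]
    rintro t (ht | ht) htv
    · simp only [mem_ofPred_eq, v, abs_lt] at ht htv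
      linarith
    · simp only [mem_iUnion, mem_ofPred_eq, v, abs_lt] at ht htv
      obtain ⟨m, ⟨-, hmn⟩, h⟩ := ht
      rcases lt_or_gt_of_ne hmn with hlt | hlt
      · have : (m : ℝ) + 1 ≤ n := by exact_mod_cast hlt
        linarith
      · have : (n : ℝ) + 1 ≤ m := by exact_mod_cast hlt
        linarith
  have hu' : IsOpen (val ⁻¹' u) := by
    refine isOpen_preimage_val hu fun _ => ?_
    filter_upwards [eventually_gt_atTop n] with m hm
    refine Or.inr (mem_biUnion (x := m) ⟨by lia, by lia⟩ ?_)
    simp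
  have hv' : IsOpen (val ⁻¹' v) := by
    refine isOpen_preimage_val hv fun h => ?_
    simp only [mem_ofPred_eq, v, abs_lt] at h
    linarith
  have hcov : C ⊆ val ⁻¹' u ∪ val ⁻¹' v := by
    intro y hy
    rcases hsub y hy with h | ⟨m, hm, h⟩
    · exact Or.inl (Or.inl h)
    · by_cases hmn : m = n
      · subst hmn
        exact Or.inr h
      · exact Or.inl (Or.inr (mem_biUnion (x := m) ⟨hm, hmn⟩ h))
  have hCu := hC.subset_left_of_subset_union hu' hv' (huv.preimage val) hcov
    ⟨mk 0, h0, Or.inl (by simpa using hε)⟩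
  exact Set.disjoint_left.1 huv (hCu hx) hxn

/-- Continuous maps from a locally connected space do not see the difference between
`PinchedLine` and the real line. -/
theorem continuous_val_comp {X : Type*} [TopologicalSpace X] [LocallyConnectedSpace X]
    {f : X → PinchedLine} (hf : Continuous f) : Continuous fun x => (f x).val := by
  rw [continuous_iff_continuousAt]
  intro x
  by_cases hx : (f x).val = 0
  · rw [Metric.continuousAt_iff']
    intro δ hδ
    obtain ⟨ε, hε, hε', hεδ⟩ : ∃ ε : ℝ, 0 < ε ∧ ε ≤ 1 / 2 ∧ ε ≤ δ :=
      ⟨min (1 / 2) δ, by positivity, min_le_left _ _, min_le_right _ _⟩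
    let s : Set ℝ := {t | |t| < ε} ∪ ⋃ m ∈ {m : ℕ | 0 < m}, {t : ℝ | |t - m| < 1 / 2}
    have hs : IsOpen s :=
      (isOpen_lt (by fun_prop) (by fun_prop)).union
        (isOpen_biUnion fun m _ => isOpen_lt (by fun_prop) (by fun_prop))
    have hs' : IsOpen (val ⁻¹' s) := by
      refine isOpen_preimage_val hs fun _ => ?_
      filter_upwards [eventually_gt_atTop 0] with m hm
      refine Or.inr (mem_biUnion (x := m) hm ?_)
      simp
    have hxs : f ⁻¹' (val ⁻¹' s) ∈ 𝓝 x :=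
      (hs'.preimage hf).mem_nhds (Or.inl (by simpa [hx] using hε))
    obtain ⟨V, hV, hVc, hVs⟩ :=
      locallyConnectedSpace_iff_connected_subsets.1 ‹_› x _ hxs
    filter_upwards [hV] with y hy
    have hfx : f x = mk 0 := by rw [← hx]
    have key := abs_val_lt_of_isPreconnected (hVc.image f hf.continuousOn)
      ⟨x, mem_of_mem_nhds hV, hfx⟩ hε hε' (by
        rintro _ ⟨z, hz, rfl⟩
        rcases hVs hz with h | h
        · exact Or.inl h
        · simp only [mem_iUnion] at h
          obtain ⟨m, hm, h⟩ := h
          exact Or.inr ⟨m, hm, h⟩) (f y) ⟨y, hy, rfl⟩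
    rw [hx, Real.dist_eq, sub_zero]
    exact key.trans_le hεδ
  · intro s hs
    obtain ⟨t, hts, ht, hxt⟩ := mem_nhds_iff.1 (inter_mem hs (isOpen_ne.mem_nhds hx))
    have ht' : IsOpen (val ⁻¹' t) := isOpen_preimage_val ht fun h => ((hts h).2 rfl).elim
    filter_upwards [(ht'.preimage hf).mem_nhds hxt] with y hy
    exact (hts hy).1

theorem mk_surjective : Function.Surjective mk := fun x => ⟨x.val, rfl⟩

instance : PathConnectedSpace PinchedLine :=
  mk_surjective.pathConnectedSpace continuous_mk

instance : SimplyConnectedSpace PinchedLine := by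
  refine simply_connected_iff_paths_homotopic'.2 ⟨inferInstance, fun {x y} p q => ?_⟩
  let lift (r : Path x y) : Path x.val y.val :=
    { toFun := fun t => (r t).val
      continuous_toFun := (continuous_val_comp r.continuous_extend).comp continuous_subtype_val |>.congr
        fun t => by simp
      source' := by simp
      target' := by simp }
  exact (SimplyConnectedSpace.paths_homotopic (lift p) (lift q)).map ⟨mk, continuous_mk⟩

end PinchedLine

namespace PinchedDouble

instance : TopologicalSpace PinchedDouble where
  IsOpen U := ∀ i, IsOpen ((mk · i) ⁻¹' U) ∧
    (mk 0 i ∈ U → ∀ᶠ n : ℕ in atTop, mk n (i + 1) ∈ U)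
  isOpen_univ := by simp
  isOpen_inter U V hU hV i :=
    ⟨(hU i).1.inter (hV i).1, fun h => ((hU i).2 h.1).and ((hV i).2 h.2)⟩
  isOpen_sUnion S hS i := by
    refine ⟨?_, ?_⟩
    · rw [preimage_sUnion]
      exact isOpen_biUnion fun U hU => (hS U hU i).1
    · rintro ⟨U, hU, h0⟩
      exact ((hS U hU i).2 h0).mono fun n hn => ⟨U, hU, hn⟩

theorem continuous_mk (i : ZMod 2) : Continuous (mk · i) :=
  continuous_def.2 fun _ hU => (hU i).1

theorem isPreconnected_range_mk (i : ZMod 2) : IsPreconnected (range (mk · i)) :=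
  isPreconnected_range (continuous_mk i)

theorem mk_zero_mem_closure (i : ZMod 2) : mk 0 i ∈ closure (range (mk · (i + 1))) := by
  rw [mem_closure_iff]
  intro U hU h0
  obtain ⟨n, hn⟩ := ((hU i).2 h0).exists
  exact ⟨_, hn, n, rfl⟩

instance : ConnectedSpace PinchedDouble where
  toNonempty := ⟨mk 0 0⟩
  isPreconnected_univ := by
    have h : IsPreconnected (insert (mk 0 0) (range (mk · 1))) :=
      (isPreconnected_range_mk 1).subset_closure (subset_insert _ _)
        (insert_subset (mk_zero_mem_closure 0) subset_closure)
    have hunion := h.union (mk 0 0) (mem_insert _ _) (mem_range_self (f := (mk · 0)) 0)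
      (isPreconnected_range_mk 0)
    refine (eq_univ_of_forall fun x => ?_) ▸ hunion
    obtain ⟨t, i⟩ := x
    fin_cases i
    · exact Or.inr ⟨t, rfl⟩
    · exact Or.inl (Or.inr ⟨t, rfl⟩)

instance : AddAction (ZMod 2) PinchedDouble where
  vadd g x := mk x.val (g + x.sheet)
  zero_vadd _ := PinchedDouble.ext rfl (zero_add _)
  add_vadd _ _ _ := PinchedDouble.ext rfl (add_assoc _ _ _)

@[simp]
theorem vadd_mk (g : ZMod 2) (t : ℝ) (i : ZMod 2) : g +ᵥ mk t i = mk t (g + i) :=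
  rfl

instance : ContinuousConstVAdd (ZMod 2) PinchedDouble where
  continuous_const_vadd g := continuous_def.2 fun U hU i => by
    refine ⟨(hU (g + i)).1, fun h => ?_⟩
    simpa [add_assoc] using (hU (g + i)).2 h

/-- The projection forgetting the sheet. -/
def proj (x : PinchedDouble) : PinchedLine :=
  .mk x.val

theorem continuous_proj : Continuous proj :=
  continuous_def.2 fun _ hU _ => ⟨hU.1, hU.2⟩

theorem proj_surjective : Function.Surjective proj := fun b => ⟨mk b.val 0, rfl⟩

theorem isOpenMap_proj : IsOpenMap proj := by
  intro V hV
  refine PinchedLine.isOpen_iff.2 ⟨?_, ?_⟩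
  · have : PinchedLine.mk ⁻¹' (proj '' V) = ⋃ i, (mk · i) ⁻¹' V := by
      ext t
      simp only [mem_preimage, mem_image, mem_iUnion]
      constructor
      · rintro ⟨x, hx, h⟩
        obtain rfl : x.val = t := congrArg PinchedLine.val h
        exact ⟨x.sheet, hx⟩
      · rintro ⟨i, hi⟩
        exact ⟨_, hi, rfl⟩
    rw [this]
    exact isOpen_iUnion fun i => (hV i).1
  · rintro ⟨x, hx, h⟩
    have hx0 : x.val = 0 := congrArg PinchedLine.val h
    have hx' : mk 0 x.sheet ∈ V := by rwa [← hx0]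
    exact ((hV _).2 hx').mono fun n hn => ⟨_, hn, rfl⟩

/-- Every point has a neighborhood that contains at most one of the two points of each fiber. -/
theorem exists_mem_nhds_injOn_proj (x : PinchedDouble) : ∃ U ∈ 𝓝 x, InjOn proj U := by
  obtain ⟨t, i⟩ := x
  have hval {x y : PinchedDouble} (h : proj x = proj y) : x.val = y.val :=
    congrArg PinchedLine.val h
  rcases lt_or_ge 0 t with ht | ht
  · refine ⟨{y | y.sheet = i ∧ 0 < y.val}, IsOpen.mem_nhds (fun j => ⟨?_, ?_⟩) ⟨rfl, ht⟩, ?_⟩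
    · change IsOpen {s : ℝ | j = i ∧ 0 < s}
      exact isOpen_const.and isOpen_Ioi
    · exact fun h => (lt_irrefl _ h.2).elim
    · exact fun x hx y hy h => PinchedDouble.ext (hval h) (hx.1.trans hy.1.symm)
  · refine ⟨{y | y.sheet = i ∧ y.val < 1 / 2 ∨ y.sheet = i + 1 ∧ 1 / 2 < y.val},
      IsOpen.mem_nhds (fun j => ⟨?_, ?_⟩) (Or.inl ⟨rfl, ?_⟩), ?_⟩
    · change IsOpen ({s : ℝ | j = i ∧ s < 1 / 2} ∪ {s : ℝ | j = i + 1 ∧ 1 / 2 < s})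
      exact (isOpen_const.and isOpen_Iio).union (isOpen_const.and isOpen_Ioi)
    · rintro (⟨h, -⟩ | ⟨-, h⟩)
      · filter_upwards [eventually_ge_atTop 1] with n hn
        have : (1 : ℝ) ≤ n := by exact_mod_cast hn
        exact Or.inr ⟨congrArg (· + 1) h, show (1 / 2 : ℝ) < n by linarith⟩
      · norm_num at h
    · simp only
      linarith
    · rintro x (hx | hx) y (hy | hy) h
      · exact PinchedDouble.ext (hval h) (hx.1.trans hy.1.symm)
      · linarith [hval h, hx.2, hy.2]
      · linarith [hval h, hx.2, hy.2]
      · exact PinchedDouble.ext (hval h) (hx.1.trans hy.1.symm)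

theorem isAddQuotientCoveringMap_proj : IsAddQuotientCoveringMap proj (ZMod 2) where
  toIsQuotientMap := isOpenMap_proj.isQuotientMap continuous_proj proj_surjective
  toContinuousConstVAdd := inferInstance
  apply_eq_iff_mem_orbit {x y} := by
    constructor
    · intro h
      have h' : x.val = y.val := congrArg PinchedLine.val h
      exact ⟨x.sheet - y.sheet, PinchedDouble.ext h'.symm (sub_add_cancel _ _)⟩
    · rintro ⟨g, rfl⟩
      rfl
  disjoint x := by
    obtain ⟨U, hU, hinj⟩ := exists_mem_nhds_injOn_proj x
    refine ⟨U, hU, ?_⟩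
    rintro g ⟨_, ⟨y, hy, rfl⟩, hgy⟩
    have : g + y.sheet = y.sheet := congrArg sheet (hinj hgy hy rfl)
    simpa using this

theorem card_fiber_proj (b : PinchedLine) : Nat.card (proj ⁻¹' {b}) = 2 := by
  rw [Nat.card_congr (isAddQuotientCoveringMap_proj.fiberEquivAddGroup (x := b) ⟨mk b.val 0, rfl⟩),
    Nat.card_zmod]

end PinchedDouble

/-- There exist nonempty connected spaces `E` and `B` with `B` path-connected and simply
connected, and a two-fold covering map `p : E → B`; in particular `p` is not injective,
so a simply connected space can admit a connected covering that is not a homeomorphism. -/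
theorem exists_twofold_covering_of_simplyConnected_base :
    ∃ (E B : TopCat) (p : E → B), Nonempty E ∧ Nonempty B ∧
      ConnectedSpace E ∧ ConnectedSpace B ∧
      PathConnectedSpace B ∧ SimplyConnectedSpace B ∧
      IsCoveringMap p ∧ (∀ b : B, Nat.card (p ⁻¹' {b}) = 2) ∧
      ¬ Function.Injective p := by
  refine ⟨.of (ULift PinchedDouble), .of (ULift PinchedLine),
    Homeomorph.ulift.symm ∘ PinchedDouble.proj ∘ Homeomorph.ulift, ⟨⟨.mk 0 0⟩⟩, ⟨⟨.mk 0⟩⟩,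
    ?_, ?_, ?_, ?_, ?_, ?_, ?_⟩
  · exact Homeomorph.ulift.symm.surjective.connectedSpace Homeomorph.ulift.symm.continuous
  · exact Homeomorph.ulift.symm.surjective.connectedSpace Homeomorph.ulift.symm.continuous
  · exact Homeomorph.ulift.symm.surjective.pathConnectedSpace Homeomorph.ulift.symm.continuous
  · exact Homeomorph.ulift.toHomotopyEquiv.simplyConnectedSpace
  · exact (PinchedDouble.isAddQuotientCoveringMap_proj.isCoveringMap.comp_homeomorph _).homeomorph_comp
      Homeomorph.ulift.symm
  · rintro ⟨b⟩
    rw [← PinchedDouble.card_fiber_proj b]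
    refine Nat.card_congr (Homeomorph.ulift.toEquiv.subtypeEquiv fun x => ?_)
    exact Homeomorph.ulift.symm.injective.eq_iff (b := b)
  · intro h
    have := congrArg (fun x => x.down.sheet) (@h ⟨.mk 0 0⟩ ⟨.mk 0 1⟩ rfl)
    exact absurd this (by decide)
end

section
/- There exist a path-connected topological space B, a connected topological space E that is not path-connected, and a covering map p : E → B; that is, a connected cover of a path-connected space need not be path-connected. -/
open Filter Topology

/-- The points of one sheet of `DoubleCover`: an infinite discrete set of teeth, all of which lie in
every neighborhood of the hub, a limit point and an open point joining the hub to the limit point. -/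
inductive SheetPoint : Type
  | hub
  | bridge
  | limit
  | tooth (n : ℕ)

open SheetPoint

/-- Two copies of the set of sheet points. The topology makes the teeth of each sheet accumulate at
the limit point of the opposite sheet. -/
@[ext]
structure DoubleCover : Type where
  /-- The sheet of a point. -/
  sheet : ℤˣ
  /-- The position of a point in its sheet. -/
  point : SheetPoint

namespace DoubleCover

instance : TopologicalSpace DoubleCover where
  IsOpen U := ∀ b,
    (⟨b, hub⟩ ∈ U → ⟨b, bridge⟩ ∈ U ∧ ∀ n, ⟨b, tooth n⟩ ∈ U) ∧
    (⟨b, limit⟩ ∈ U → ⟨b, bridge⟩ ∈ U ∧ ∀ᶠ n in atTop, ⟨-b, tooth n⟩ ∈ U)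
  isOpen_univ b := by simp
  isOpen_inter U V hU hV b :=
    ⟨fun h ↦ ⟨⟨((hU b).1 h.1).1, ((hV b).1 h.2).1⟩,
        fun n ↦ ⟨((hU b).1 h.1).2 n, ((hV b).1 h.2).2 n⟩⟩,
      fun h ↦ ⟨⟨((hU b).2 h.1).1, ((hV b).2 h.2).1⟩,
        ((hU b).2 h.1).2.and ((hV b).2 h.2).2⟩⟩
  isOpen_sUnion S hS b := by
    refine ⟨?_, ?_⟩
    · rintro ⟨U, hU, h⟩
      exact ⟨⟨U, hU, ((hS U hU b).1 h).1⟩, fun n ↦ ⟨U, hU, ((hS U hU b).1 h).2 n⟩⟩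
    · rintro ⟨U, hU, h⟩
      exact ⟨⟨U, hU, ((hS U hU b).2 h).1⟩,
        ((hS U hU b).2 h).2.mono fun n hn ↦ ⟨U, hU, hn⟩⟩

theorem isOpen_iff {U : Set DoubleCover} : IsOpen U ↔ ∀ b,
    (⟨b, hub⟩ ∈ U → ⟨b, bridge⟩ ∈ U ∧ ∀ n, ⟨b, tooth n⟩ ∈ U) ∧
    (⟨b, limit⟩ ∈ U → ⟨b, bridge⟩ ∈ U ∧ ∀ᶠ n in atTop, ⟨-b, tooth n⟩ ∈ U) :=
  Iff.rfl

theorem tooth_specializes_hub (b : ℤˣ) (n : ℕ) :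
    (⟨b, tooth n⟩ : DoubleCover) ⤳ ⟨b, hub⟩ :=
  specializes_iff_forall_open.2 fun _ hU h ↦ ((isOpen_iff.1 hU b).1 h).2 n

theorem bridge_specializes_hub (b : ℤˣ) : (⟨b, bridge⟩ : DoubleCover) ⤳ ⟨b, hub⟩ :=
  specializes_iff_forall_open.2 fun _ hU h ↦ ((isOpen_iff.1 hU b).1 h).1

theorem bridge_specializes_limit (b : ℤˣ) : (⟨b, bridge⟩ : DoubleCover) ⤳ ⟨b, limit⟩ :=
  specializes_iff_forall_open.2 fun _ hU h ↦ ((isOpen_iff.1 hU b).2 h).1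

theorem joined_hub (e : DoubleCover) : Joined ⟨e.sheet, hub⟩ e := by
  have joined {x y : DoubleCover} (h : x ⤳ y) : Joined x y :=
    (h.joinedIn (Set.mem_univ x) (Set.mem_univ y)).joined
  obtain ⟨b, _ | _ | _ | n⟩ := e
  · exact .refl _
  · exact (joined (bridge_specializes_hub b)).symm
  · exact (joined (bridge_specializes_hub b)).symm.trans (joined (bridge_specializes_limit b))
  · exact (joined (tooth_specializes_hub b n)).symm

instance : ConnectedSpace DoubleCover := by
  have : Nonempty DoubleCover := ⟨⟨1, hub⟩⟩
  have mem_of_mem {U : Set DoubleCover} (hU : IsClopen U) {x y : DoubleCover} (h : Joined x y)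
      (hx : x ∈ U) : y ∈ U :=
    hU.connectedComponent_subset hx (pathComponent_subset_component x h)
  have hub_neg {U : Set DoubleCover} (hU : IsClopen U) {b : ℤˣ} (h : ⟨b, hub⟩ ∈ U) :
      ⟨-b, hub⟩ ∈ U := by
    have hlim := mem_of_mem hU (joined_hub ⟨b, limit⟩) h
    obtain ⟨n, hn⟩ := ((isOpen_iff.1 hU.isOpen b).2 hlim).2.exists
    exact mem_of_mem hU (joined_hub ⟨-b, tooth n⟩).symm hn
  have : PreconnectedSpace DoubleCover := by
    refine preconnectedSpace_iff_clopen.2 fun U hU ↦ ?_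
    refine U.eq_empty_or_nonempty.imp_right ?_
    rintro ⟨e, he⟩
    refine Set.eq_univ_of_forall fun e' ↦ mem_of_mem hU (joined_hub e') ?_
    have h := mem_of_mem hU (joined_hub e).symm he
    obtain h' | h' : e'.sheet = e.sheet ∨ e'.sheet = -e.sheet := by
      rcases Int.units_eq_one_or e'.sheet with h₁ | h₁ <;>
        rcases Int.units_eq_one_or e.sheet with h₂ | h₂ <;> simp [h₁, h₂]
    · rwa [h']
    · rw [h']; exact hub_neg hU h
  exact ⟨inferInstance⟩

/-- The points of the sheet `b` together with all teeth. -/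
def sheetWithTeeth (b : ℤˣ) : Set DoubleCover := {e | e.sheet = b ∨ ∃ n, e.point = tooth n}

theorem isOpen_sheetWithTeeth (b : ℤˣ) : IsOpen (sheetWithTeeth b) :=
  isOpen_iff.2 fun b' ↦ by simp [sheetWithTeeth]

theorem isOpen_singleton_tooth (b : ℤˣ) (n : ℕ) :
    IsOpen {(⟨b, tooth n⟩ : DoubleCover)} :=
  isOpen_iff.2 fun b' ↦ by simp

theorem isOpen_sheetWithTeeth_diff_tooth {b b' : ℤˣ} (hb : b' ≠ b) (n : ℕ) :
    IsOpen (sheetWithTeeth b \ {⟨b', tooth n⟩}) := by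
  refine isOpen_iff.2 fun a ↦ ⟨?_, ?_⟩
  · rintro ⟨h, -⟩
    have ha : a = b := h.resolve_right (by simp)
    exact ⟨⟨.inl ha, by simp⟩, fun m ↦ ⟨.inl ha, by simp [ha, hb.symm]⟩⟩
  · rintro ⟨h, -⟩
    exact ⟨⟨.inl (h.resolve_right (by simp)), by simp⟩,
      (eventually_gt_atTop n).mono fun m hm ↦ ⟨.inr ⟨m, rfl⟩, by simp [hm.ne']⟩⟩

theorem sheet_eq_of_isPreconnected {s : Set DoubleCover} {b : ℤˣ} (hs : IsPreconnected s)
    (hsub : s ⊆ sheetWithTeeth b) {x y : DoubleCover} (hx : x ∈ s) (hy : y ∈ s)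
    (hxb : x.sheet = b) : y.sheet = b := by
  by_contra hne
  obtain ⟨n, hn⟩ := (hsub hy).resolve_left hne
  have hyt : y = ⟨y.sheet, tooth n⟩ := DoubleCover.ext rfl hn
  have h := hs.subset_left_of_subset_union (isOpen_singleton_tooth y.sheet n)
    (isOpen_sheetWithTeeth_diff_tooth hne n) Set.disjoint_sdiff_right
    (by rw [Set.union_sdiff_self]; exact hsub.trans Set.subset_union_right) ⟨y, hy, hyt⟩ hx
  exact hne (by rw [← hxb, Set.mem_singleton_iff.1 h])

theorem isLocallyConstant_sheet_comp {X : Type*} [TopologicalSpace X] [LocallyConnectedSpace X]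
    {f : X → DoubleCover} (hf : Continuous f) : IsLocallyConstant fun x ↦ (f x).sheet := by
  refine (IsLocallyConstant.iff_eventually_eq _).2 fun x ↦ ?_
  obtain ⟨V, hV, hVo, hxV, hVc⟩ := locallyConnectedSpace_iff_subsets_isOpen_isConnected.1 ‹_› x _
    (((isOpen_sheetWithTeeth (f x).sheet).preimage hf).mem_nhds (Or.inl rfl))
  filter_upwards [hVo.mem_nhds hxV] with y hy
  exact sheet_eq_of_isPreconnected (hVc.isPreconnected.image f hf.continuousOn)
    (Set.image_subset_iff.2 hV) (Set.mem_image_of_mem f hxV) (Set.mem_image_of_mem f hy) rfl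

theorem sheet_eq_of_joined {x y : DoubleCover} (h : Joined x y) : x.sheet = y.sheet := by
  obtain ⟨γ⟩ := h
  have := (isLocallyConstant_sheet_comp γ.continuous_extend).apply_eq_of_preconnectedSpace 0 1
  simpa using this

theorem not_pathConnectedSpace : ¬ PathConnectedSpace DoubleCover := fun h ↦
  absurd (sheet_eq_of_joined (h.joined ⟨1, hub⟩ ⟨-1, hub⟩)) (by decide)

instance : MulAction ℤˣ DoubleCover where
  smul u e := ⟨u * e.sheet, e.point⟩
  one_smul _ := DoubleCover.ext (one_mul _) rfl
  mul_smul u v e := DoubleCover.ext (mul_assoc u v e.sheet) rfl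

theorem smul_def (u : ℤˣ) (e : DoubleCover) : u • e = ⟨u * e.sheet, e.point⟩ :=
  rfl

instance : ContinuousConstSMul ℤˣ DoubleCover where
  continuous_const_smul u := by
    refine continuous_def.2 fun U hU ↦ isOpen_iff.2 fun b ↦ ?_
    simpa [smul_def] using isOpen_iff.1 hU (u * b)

/-- The hub, the bridge and the teeth of one sheet. -/
def hubNhd (b : ℤˣ) : Set DoubleCover := {e | e.sheet = b ∧ e.point ≠ limit}

theorem isOpen_hubNhd (b : ℤˣ) : IsOpen (hubNhd b) :=
  isOpen_iff.2 fun b' ↦ by simp [hubNhd]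

/-- The limit point and the bridge of one sheet together with the teeth of the other sheet. -/
def limitNhd (b : ℤˣ) : Set DoubleCover :=
  {e | (e.sheet = b ∧ (e.point = limit ∨ e.point = bridge)) ∨
    (e.sheet = -b ∧ ∃ n, e.point = tooth n)}

theorem isOpen_limitNhd (b : ℤˣ) : IsOpen (limitNhd b) :=
  isOpen_iff.2 fun b' ↦ by simp +contextual [limitNhd]

theorem eq_one_of_smul_mem_hubNhd {b u : ℤˣ} {e : DoubleCover} (he : e ∈ hubNhd b)
    (hu : u • e ∈ hubNhd b) : u = 1 := by
  have h : u * e.sheet = b := hu.1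
  rwa [he.1, mul_eq_right] at h

theorem eq_one_of_smul_mem_limitNhd {b u : ℤˣ} {e : DoubleCover} (he : e ∈ limitNhd b)
    (hu : u • e ∈ limitNhd b) : u = 1 := by
  obtain ⟨a, p⟩ := e
  cases p <;> simp_all [limitNhd, smul_def]

theorem exists_mem_nhds_smul_disjoint (e : DoubleCover) :
    ∃ U ∈ 𝓝 e, ∀ u : ℤˣ, ((u • ·) '' U ∩ U).Nonempty → u = 1 := by
  by_cases he : e.point = limit
  · refine ⟨limitNhd e.sheet, (isOpen_limitNhd _).mem_nhds (.inl ⟨rfl, .inl he⟩), ?_⟩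
    rintro u ⟨_, ⟨x, hx, rfl⟩, hux⟩
    exact eq_one_of_smul_mem_limitNhd hx hux
  · refine ⟨hubNhd e.sheet, (isOpen_hubNhd _).mem_nhds ⟨rfl, he⟩, ?_⟩
    rintro u ⟨_, ⟨x, hx, rfl⟩, hux⟩
    exact eq_one_of_smul_mem_hubNhd hx hux

/-- The quotient of `DoubleCover` by the swap of the two sheets. -/
abbrev Base : Type := MulAction.orbitRel.Quotient ℤˣ DoubleCover

theorem isQuotientCoveringMap_mk :
    IsQuotientCoveringMap (Quotient.mk _ : DoubleCover → Base) ℤˣ where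
  toIsQuotientMap := isQuotientMap_quotient_mk'
  toContinuousConstSMul := inferInstance
  apply_eq_iff_mem_orbit := Quotient.eq
  disjoint := exists_mem_nhds_smul_disjoint

theorem pathConnectedSpace_base : PathConnectedSpace Base := by
  have hp := isQuotientCoveringMap_mk
  have joined_mk (e : DoubleCover) :
      Joined (Quotient.mk _ ⟨1, hub⟩ : Base) (Quotient.mk _ e) := by
    have h : (Quotient.mk _ ⟨1, hub⟩ : Base) = Quotient.mk _ ⟨e.sheet, hub⟩ := by
      rw [← hp.map_smul e.sheet, smul_def, mul_one]
    rw [h]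
    exact (joined_hub e).map hp.continuous
  refine ⟨⟨Quotient.mk _ ⟨1, hub⟩⟩, fun x y ↦ ?_⟩
  induction x using Quotient.inductionOn with | _ x
  induction y using Quotient.inductionOn with | _ y
  exact (joined_mk x).symm.trans (joined_mk y)

end DoubleCover

/-- A connected cover of a path-connected space need not be path-connected: there exist a
path-connected space `B`, a connected but not path-connected space `E`, and a covering map
`p : E → B`. -/
theorem exists_connected_non_pathConnected_cover_of_pathConnected :
    ∃ (E B : TopCat) (p : E → B), PathConnectedSpace B ∧
      ConnectedSpace E ∧ ¬ PathConnectedSpace E ∧ IsCoveringMap p := by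
  have := DoubleCover.pathConnectedSpace_base
  let p : DoubleCover → DoubleCover.Base := Quotient.mk _
  refine ⟨TopCat.of (ULift DoubleCover), TopCat.of (ULift DoubleCover.Base),
    Homeomorph.ulift.symm ∘ p ∘ Homeomorph.ulift,
    Homeomorph.ulift.symm.surjective.pathConnectedSpace Homeomorph.ulift.symm.continuous,
    Homeomorph.ulift.symm.surjective.connectedSpace Homeomorph.ulift.symm.continuous,
    fun _ ↦ DoubleCover.not_pathConnectedSpace
      (Homeomorph.ulift.surjective.pathConnectedSpace Homeomorph.ulift.continuous), ?_⟩
  exact (DoubleCover.isQuotientCoveringMap_mk.isCoveringMap.comp_homeomorph _).homeomorph_comp _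
end

section
/- There exist nonempty connected topological spaces E and B and a covering map p : E → B every fiber of which has exactly two elements, such that B is path-connected and simply connected and every path component of E (with the subspace topology) is locally path-connected. -/
open Set Topology Filter

section Abstract

variable {A E B : Type*} [TopologicalSpace A] [TopologicalSpace E] [TopologicalSpace B]

/-- The base of a covering is simply connected as soon as some simply connected space embeds in the
total space as a union of path components that the covering maps bijectively onto the base. -/
theorem IsCoveringMap.simplyConnectedSpace_of_isEmbedding [SimplyConnectedSpace A]
    {p : E → B} (hp : IsCoveringMap p) {c : A → E} (hc : IsEmbedding c)
    (hbij : Function.Bijective (p ∘ c))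
    (hjoin : ∀ x y, Joined x y → x ∈ range c → y ∈ range c) : SimplyConnectedSpace B := by
  have : PathConnectedSpace unitInterval :=
    isPathConnected_iff_pathConnectedSpace.1 ((convex_Icc (0 : ℝ) 1).isPathConnected ⟨0, by simp⟩)
  have hcont : Continuous (p ∘ c) := hp.continuous.comp hc.continuous
  have lift (a b : A) (γ : Path ((p ∘ c) a) ((p ∘ c) b)) :
      ∃ δ : Path a b, δ.map hcont = γ := by
    obtain ⟨Γ, hΓ, hΓ0⟩ := hp.exists_path_lifts γ.toContinuousMap (c a) (by simp)
    have hmem (t : unitInterval) : Γ t ∈ range c := by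
      refine hjoin (Γ 0) (Γ t) ?_ (hΓ0 ▸ mem_range_self a)
      exact (PathConnectedSpace.joined 0 t).map Γ.continuous
    let δ : unitInterval → A := fun t ↦ hc.toHomeomorph.symm ⟨Γ t, hmem t⟩
    have hδ (t) : c (δ t) = Γ t := by
      have := hc.toHomeomorph.apply_symm_apply ⟨Γ t, hmem t⟩
      exact congrArg Subtype.val this
    have hΓt (t) : p (Γ t) = γ t := congrFun hΓ t
    refine ⟨⟨⟨δ, by fun_prop⟩, ?_, ?_⟩, ?_⟩
    · exact hc.injective ((hδ 0).trans hΓ0)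
    · exact hbij.1 (by simp [hδ, hΓt])
    · ext t
      simpa [hδ] using hΓt t
  refine simply_connected_iff_paths_homotopic'.mpr ⟨hbij.2.pathConnectedSpace hcont, ?_⟩
  intro x y γ₁ γ₂
  obtain ⟨a, rfl⟩ := hbij.2 x
  obtain ⟨b, rfl⟩ := hbij.2 y
  obtain ⟨δ₁, rfl⟩ := lift a b γ₁
  obtain ⟨δ₂, rfl⟩ := lift a b γ₂
  exact (SimplyConnectedSpace.paths_homotopic δ₁ δ₂).map ⟨_, hcont⟩

theorem Topology.IsEmbedding.locallyPathConnectedSpace_pathComponent [PathConnectedSpace A]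
    [LocallyPathConnectedSpace A] {c : A → E} (hc : IsEmbedding c)
    (hjoin : ∀ x y, Joined x y → x ∈ range c → y ∈ range c) {x : E} (hx : x ∈ range c) :
    LocallyPathConnectedSpace (pathComponent x) := by
  have hrange : range c = pathComponent x := by
    refine Subset.antisymm ?_ fun y hy ↦ hjoin x y hy hx
    exact (isPathConnected_range hc.continuous).subset_pathComponent hx
  exact (hc.toHomeomorph.trans (.setCongr hrange)).symm.isOpenEmbedding.locallyPathConnectedSpace

/-- The quotient of a Hausdorff space by a free continuous action of `ℤˣ` is a covering. -/
theorem isQuotientCoveringMap_quotientMk_units_int [T2Space E] [MulAction ℤˣ E]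
    [ContinuousConstSMul ℤˣ E] (hfree : ∀ e : E, (-1 : ℤˣ) • e ≠ e) :
    IsQuotientCoveringMap (Quotient.mk (MulAction.orbitRel ℤˣ E)) ℤˣ where
  __ := isQuotientMap_quotient_mk'
  apply_eq_iff_mem_orbit := Quotient.eq''
  disjoint e := by
    obtain ⟨V, W, hV, hW, heV, heW, hVW⟩ := t2_separation (hfree e)
    refine ⟨W ∩ ((-1 : ℤˣ) • ·) ⁻¹' V, inter_mem (hW.mem_nhds heW)
      ((hV.preimage (continuous_const_smul _)).mem_nhds heV), fun g hg ↦ ?_⟩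
    obtain rfl | rfl := Int.units_eq_one_or g
    · rfl
    · obtain ⟨_, ⟨y, hy, rfl⟩, hy'⟩ := hg
      exact (hVW.le_bot ⟨hy.2, hy'.1⟩).elim

end Abstract

namespace OscillatingArc

/-- A graph-like arc in space, oscillating near its missing endpoint; it accumulates there at the
antipode of its other endpoint. -/
noncomputable def curve (x : ℝ) : ℝ × ℝ × ℝ :=
  (x, Real.sin (Real.pi * (1 / (x + 1) - 1 / 2)), 1 - x ^ 2)

/-- The image of the half-open interval `(-1, 1]` under `curve`. -/
def arc : Set (ℝ × ℝ × ℝ) := curve '' Ioc (-1) 1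

/-- The union of `arc` and its antipode. -/
def doubleArc : Set (ℝ × ℝ × ℝ) := {v | v ∈ arc ∨ -v ∈ arc}

theorem continuousOn_curve : ContinuousOn curve (Ioc (-1) 1) := by
  have : ∀ x ∈ Ioc (-1 : ℝ) 1, x + 1 ≠ 0 := fun x hx ↦ by linarith [hx.1]
  unfold curve
  fun_prop (disch := assumption)

theorem neg_notMem_arc {v : ℝ × ℝ × ℝ} (hv : v ∈ arc) : -v ∉ arc := by
  rintro ⟨y, hy, hyv⟩
  obtain ⟨x, hx, rfl⟩ := hv
  simp only [curve, Prod.neg_mk, Prod.mk.injEq] at hyv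
  obtain ⟨h₁, -, h₃⟩ := hyv
  obtain ⟨hx₁, hx₂⟩ := hx
  obtain ⟨hy₁, hy₂⟩ := hy
  nlinarith

theorem neg_mem_doubleArc {v : ℝ × ℝ × ℝ} (hv : v ∈ doubleArc) : -v ∈ doubleArc := by
  simpa [doubleArc, or_comm] using hv

theorem mem_arc_of_pos {v : ℝ × ℝ × ℝ} (hv : v ∈ doubleArc) (h : 0 < v.2.2) : v ∈ arc := by
  refine hv.resolve_right ?_
  rintro ⟨x, hx, hxv⟩
  have : 1 - x ^ 2 = -v.2.2 := congrArg (fun w : ℝ × ℝ × ℝ ↦ w.2.2) hxv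
  nlinarith [hx.1, hx.2]

/-- The points where the arc is at level zero converge to the antipode of its endpoint. -/
theorem neg_curve_one_mem_closure_arc : -curve 1 ∈ closure arc := by
  have hlim : Tendsto (fun n : ℕ ↦ 1 / ((n : ℝ) + 1 / 2) - 1) atTop (𝓝 (-1)) := by
    have : Tendsto (fun n : ℕ ↦ ((n : ℝ) + 1 / 2)) atTop atTop :=
      tendsto_atTop_add_const_right _ _ tendsto_natCast_atTop_atTop
    simpa using this.inv_tendsto_atTop.sub_const 1
  have hcurve (n : ℕ) : curve (1 / ((n : ℝ) + 1 / 2) - 1) =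
      (1 / ((n : ℝ) + 1 / 2) - 1, 0, 1 - (1 / ((n : ℝ) + 1 / 2) - 1) ^ 2) := by
    simp [curve, mul_comm Real.pi]
  have hone : -curve 1 = ((-1 : ℝ), (0 : ℝ), 1 - (-1 : ℝ) ^ 2) := by
    norm_num [curve]
  rw [hone]
  refine mem_closure_of_tendsto (f := fun n : ℕ ↦ curve (1 / ((n : ℝ) + 1 / 2) - 1))
    (b := atTop) ?_ (.of_forall fun n ↦ mem_image_of_mem _ ⟨?_, ?_⟩)
  · simp only [hcurve]
    exact hlim.prodMk_nhds (tendsto_const_nhds.prodMk_nhds ((hlim.pow 2).const_sub 1))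
  · have : 0 < 1 / ((n : ℝ) + 1 / 2) := by positivity
    linarith
  · have : 1 / ((n : ℝ) + 1 / 2) ≤ 2 := by
      rw [div_le_iff₀ (by positivity)]
      linarith [n.cast_nonneg (α := ℝ)]
    linarith

theorem isConnected_doubleArc : IsConnected doubleArc := by
  have hmem : (1 : ℝ) ∈ Ioc (-1 : ℝ) 1 := by norm_num
  have harc : IsPreconnected arc := isPreconnected_Ioc.image _ continuousOn_curve
  have hinsert : IsPreconnected (insert (-curve 1) arc) :=
    harc.subset_closure (subset_insert _ _)
      (insert_subset neg_curve_one_mem_closure_arc subset_closure)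
  have hneg : IsPreconnected (Neg.neg '' arc) := harc.image _ continuous_neg.continuousOn
  have heq : doubleArc = insert (-curve 1) arc ∪ Neg.neg '' arc := by
    ext v
    have : -curve 1 ∈ Neg.neg '' arc := mem_image_of_mem _ (mem_image_of_mem _ hmem)
    simp only [image_neg_eq_neg, Set.mem_neg] at this
    simp only [doubleArc, image_neg_eq_neg, mem_union, mem_insert_iff, Set.mem_neg, mem_ofPred_eq]
    constructor
    · tauto
    · rintro ((rfl | h) | h) <;> tauto
  refine ⟨⟨curve 1, .inl (mem_image_of_mem _ hmem)⟩, ?_⟩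
  rw [heq]
  exact hinsert.union (-curve 1) (mem_insert _ _)
    (mem_image_of_mem _ (mem_image_of_mem _ hmem)) hneg

/-- In every left neighbourhood of `1` there is a parameter `b` such that the point `-curve (-b)` of
the antipodal arc has second coordinate `-1`. -/
theorem exists_sin_eq_one {a : ℝ} (ha : a < 1) :
    ∃ b, a < b ∧ 0 < b ∧ b < 1 ∧ Real.sin (Real.pi * (1 / (-b + 1) - 1 / 2)) = 1 := by
  obtain ⟨n, hn⟩ := exists_nat_gt (1 / (1 - a))
  have hn' : 0 < (n : ℝ) := lt_trans (by have := sub_pos.2 ha; positivity) hn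
  have hpos : 0 < 2 * (n : ℝ) + 1 := by positivity
  have h1 : 1 < n * (1 - a) := by rwa [div_lt_iff₀ (sub_pos.2 ha)] at hn
  refine ⟨1 - 1 / (2 * n + 1), ?_, ?_, ?_, ?_⟩
  · have : 1 / (2 * (n : ℝ) + 1) < 1 - a := by
      rw [div_lt_iff₀ hpos]; nlinarith
    linarith
  · have : 1 / (2 * (n : ℝ) + 1) < 1 := by
      rw [div_lt_iff₀ hpos]; linarith
    linarith
  · have : 0 < 1 / (2 * (n : ℝ) + 1) := by positivity
    linarith
  · have : Real.pi * (1 / (-(1 - 1 / (2 * (n : ℝ) + 1)) + 1) - 1 / 2) =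
        Real.pi / 2 + n * (2 * Real.pi) := by
      rw [neg_sub, sub_add_cancel, one_div_one_div]; ring
    rw [this, Real.sin_add_nat_mul_two_pi, Real.sin_pi_div_two]

theorem isOpen_preimage_arc {T : Type*} [TopologicalSpace T] [LocallyConnectedSpace T]
    {γ : T → ℝ × ℝ × ℝ} (hγ : Continuous γ) (hmem : ∀ t, γ t ∈ doubleArc) :
    IsOpen (γ ⁻¹' arc) := by
  refine isOpen_iff_mem_nhds.2 fun s hs ↦ ?_
  obtain hpos | hnonpos := lt_or_ge 0 (γ s).2.2
  · have hopen : IsOpen {t | 0 < (γ t).2.2} := isOpen_lt continuous_const (by fun_prop)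
    filter_upwards [hopen.mem_nhds hpos] with t ht
    exact mem_arc_of_pos (hmem t) ht
  obtain ⟨x, hx, hxs⟩ := id hs
  have hx1 : x = 1 := by
    simp only [← hxs, curve] at hnonpos
    nlinarith [hx.1, hx.2]
  subst hx1
  have hfst : IsOpen {t | 0 < (γ t).1} := isOpen_lt continuous_const (by fun_prop)
  have hsnd : IsOpen {t | -1 < (γ t).2.1} := isOpen_lt continuous_const (by fun_prop)
  have hopen : IsOpen {t | 0 < (γ t).1 ∧ -1 < (γ t).2.1} := hfst.and hsnd
  have hs' : s ∈ {t | 0 < (γ t).1 ∧ -1 < (γ t).2.1} := by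
    norm_num [← hxs, curve]
  obtain ⟨V, hVsub, hVopen, hsV, hVconn⟩ :=
    locallyConnectedSpace_iff_subsets_isOpen_isConnected.1 ‹_› s _ (hopen.mem_nhds hs')
  filter_upwards [hVopen.mem_nhds hsV] with t ht
  refine (hmem t).resolve_right ?_
  rintro ⟨y, hy, hyt⟩
  have hty : γ t = -curve y := by rw [hyt, neg_neg]
  have hy0 : y < 0 := by
    have := (hVsub ht).1
    rw [hty] at this
    simpa [curve] using this
  obtain ⟨b, hab, hb0, hb1, hb⟩ := exists_sin_eq_one (a := -y) (by linarith [hy.1])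
  have hIcc : -(1 - b ^ 2) ∈ Icc (γ t).2.2 (γ s).2.2 := by
    rw [hty, ← hxs]
    constructor <;> simp only [curve, Prod.snd_neg] <;> nlinarith
  obtain ⟨r, hr, hrb⟩ := hVconn.isPreconnected.intermediate_value ht hsV
    (f := fun t ↦ (γ t).2.2) (by fun_prop) hIcc
  have hrpos := hVsub hr
  obtain ⟨z, hz, hzr⟩ | ⟨z, hz, hzr⟩ := hmem r
  · simp only [← hzr, curve] at hrb
    nlinarith [hz.1, hz.2]
  · have hrz : γ r = -curve z := by rw [hzr, neg_neg]
    simp only [hrz, curve, Prod.neg_mk, mem_ofPred_eq] at hrb hrpos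
    have : z = -b := by nlinarith
    subst this
    rw [hb] at hrpos
    exact lt_irrefl _ hrpos.2

theorem mem_arc_of_joined {x y : doubleArc} (h : Joined x y) (hx : x.1 ∈ arc) : y.1 ∈ arc := by
  obtain ⟨γ⟩ := h
  have : LocallyPathConnectedSpace unitInterval := (convex_Icc (0 : ℝ) 1).locallyPathConnectedSpace
  have hcont : Continuous fun t ↦ (γ t).1 := by fun_prop
  have hclopen : IsClopen ((fun t ↦ (γ t).1) ⁻¹' arc) := by
    refine ⟨⟨?_⟩, isOpen_preimage_arc hcont fun t ↦ (γ t).2⟩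
    convert isOpen_preimage_arc hcont.neg fun t ↦ neg_mem_doubleArc (γ t).2 using 1
    ext t
    exact ⟨(γ t).2.resolve_left, fun h h' ↦ neg_notMem_arc h' h⟩
  have huniv := hclopen.eq_univ ⟨0, by simpa using hx⟩
  simpa using (huniv ▸ mem_univ 1 : (1 : unitInterval) ∈ (fun t ↦ (γ t).1) ⁻¹' arc)

/-- The parametrization of `arc` inside `doubleArc`. -/
noncomputable def param (x : Ioc (-1 : ℝ) 1) : doubleArc :=
  ⟨curve x, .inl (mem_image_of_mem _ x.2)⟩

theorem mem_range_param {v : doubleArc} : v ∈ range param ↔ v.1 ∈ arc := by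
  simp [param, arc, Subtype.ext_iff]

theorem isEmbedding_param : IsEmbedding param := by
  have hcont : Continuous param :=
    (continuousOn_iff_continuous_domRestrict.1 continuousOn_curve).subtype_mk _
  have hfst : Continuous fun v : doubleArc ↦ v.1.1 := by fun_prop
  exact IsEmbedding.of_comp hcont hfst IsEmbedding.subtypeVal

noncomputable instance : MulAction ℤˣ doubleArc where
  smul g v := ⟨g • v.1, by
    obtain rfl | rfl := Int.units_eq_one_or g
    · simp
    · simpa [Units.smul_def] using neg_mem_doubleArc v.2⟩
  one_smul v := Subtype.ext (one_smul _ _)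
  mul_smul g h v := Subtype.ext (mul_smul _ _ _)

theorem coe_neg_one_smul (v : doubleArc) : (((-1 : ℤˣ) • v : doubleArc) : ℝ × ℝ × ℝ) = -v.1 := by
  change (-1 : ℤˣ) • v.1 = -v.1
  simp [Units.smul_def]

instance : ContinuousConstSMul ℤˣ doubleArc where
  continuous_const_smul g := by
    obtain rfl | rfl := Int.units_eq_one_or g
    · simpa using continuous_id'
    · refine continuous_induced_rng.2 ?_
      simp only [Function.comp_def, coe_neg_one_smul]
      fun_prop

theorem mem_arc_or_smul_mem_arc (v : doubleArc) :
    v.1 ∈ arc ∨ ((-1 : ℤˣ) • v : doubleArc).1 ∈ arc := by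
  rw [coe_neg_one_smul]
  exact v.2

/-- The quotient of `doubleArc` by the antipodal involution. -/
abbrev Base : Type := MulAction.orbitRel.Quotient ℤˣ doubleArc

/-- The projection of `doubleArc` to its quotient. -/
noncomputable def proj : doubleArc → Base := Quotient.mk _

theorem isQuotientCoveringMap_proj : IsQuotientCoveringMap proj ℤˣ := by
  refine isQuotientCoveringMap_quotientMk_units_int fun v hv ↦ ?_
  have h : -v.1 = v.1 := by rw [← coe_neg_one_smul, hv]
  obtain hv' | hv' := v.2
  · exact neg_notMem_arc hv' (by rwa [h])
  · exact neg_notMem_arc (by rwa [← h]) hv'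

theorem bijective_proj_comp_param : Function.Bijective (proj ∘ param) := by
  constructor
  · intro x y hxy
    obtain ⟨g, hg⟩ := isQuotientCoveringMap_proj.apply_eq_iff_mem_orbit.1 hxy
    obtain rfl | rfl := Int.units_eq_one_or g
    · exact isEmbedding_param.injective (by simpa using hg.symm)
    · have hx : (param x).1 ∈ arc := mem_range_param.1 (mem_range_self x)
      rw [← hg, coe_neg_one_smul] at hx
      exact (neg_notMem_arc (mem_range_param.1 (mem_range_self y)) hx).elim
  · intro b
    obtain ⟨v, rfl⟩ := isQuotientCoveringMap_proj.surjective b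
    obtain hv | hv := mem_arc_or_smul_mem_arc v
    · obtain ⟨x, rfl⟩ := mem_range_param.2 hv
      exact ⟨x, rfl⟩
    · obtain ⟨x, hx⟩ := mem_range_param.2 hv
      exact ⟨x, by simp [hx, isQuotientCoveringMap_proj.map_smul]⟩

theorem card_fiber_proj (b : Base) : Nat.card (proj ⁻¹' {b}) = 2 := by
  obtain ⟨v, hv⟩ := isQuotientCoveringMap_proj.surjective b
  rw [Nat.card_congr (isQuotientCoveringMap_proj.fiberEquivGroup ⟨v, hv⟩),
    Nat.card_eq_fintype_card, Fintype.card_units_int]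

instance : ContractibleSpace (Ioc (-1 : ℝ) 1) :=
  (convex_Ioc _ _).contractibleSpace ⟨1, by norm_num⟩

instance : LocallyPathConnectedSpace (Ioc (-1 : ℝ) 1) :=
  (convex_Ioc _ _).locallyPathConnectedSpace

theorem mem_range_param_of_joined (x y : doubleArc) (h : Joined x y) (hx : x ∈ range param) :
    y ∈ range param :=
  mem_range_param.2 (mem_arc_of_joined h (mem_range_param.1 hx))

theorem mem_range_smul_param_of_joined (x y : doubleArc) (h : Joined x y)
    (hx : x ∈ range fun t ↦ (-1 : ℤˣ) • param t) : y ∈ range fun t ↦ (-1 : ℤˣ) • param t := by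
  obtain ⟨t, rfl⟩ := hx
  have h' : Joined ((-1 : ℤˣ) • (-1 : ℤˣ) • param t) ((-1 : ℤˣ) • y) :=
    h.map (continuous_const_smul _)
  obtain ⟨s, hs⟩ := mem_range_param_of_joined _ _ h' (by simp [smul_smul])
  exact ⟨s, by simp [hs, smul_smul]⟩

theorem locallyPathConnectedSpace_pathComponent (x : doubleArc) :
    LocallyPathConnectedSpace (pathComponent x) := by
  obtain hx | hx := mem_arc_or_smul_mem_arc x
  · exact isEmbedding_param.locallyPathConnectedSpace_pathComponent mem_range_param_of_joined
      (mem_range_param.2 hx)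
  · refine ((Homeomorph.smul (-1 : ℤˣ)).isEmbedding.comp
      isEmbedding_param).locallyPathConnectedSpace_pathComponent
      mem_range_smul_param_of_joined ?_
    obtain ⟨t, ht⟩ := mem_range_param.2 hx
    exact ⟨t, by simp [ht, smul_smul]⟩

end OscillatingArc

theorem Homeomorph.locallyPathConnectedSpace_pathComponent {X Y : Type*} [TopologicalSpace X]
    [TopologicalSpace Y] (φ : X ≃ₜ Y) (y : Y)
    [LocallyPathConnectedSpace (pathComponent (φ.symm y))] :
    LocallyPathConnectedSpace (pathComponent y) := by
  have h (z : Y) : z ∈ pathComponent y ↔ φ.symm z ∈ pathComponent (φ.symm y) :=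
    ⟨fun hz ↦ Joined.map hz φ.symm.continuous, fun hz ↦ by
      have := Joined.map hz φ.continuous
      rwa [φ.apply_symm_apply, φ.apply_symm_apply] at this⟩
  exact (φ.symm.subtype h).isOpenEmbedding.locallyPathConnectedSpace

open OscillatingArc

/-- There is a two-fold covering `p : E → B` of nonempty connected spaces with `B`
path-connected and simply connected and every path component of `E` locally
path-connected. -/
theorem exists_twofold_covering_with_locPathConnected_path_components :
    ∃ (E B : TopCat) (p : E → B), Nonempty E ∧ Nonempty B ∧
      ConnectedSpace E ∧ ConnectedSpace B ∧
      IsCoveringMap p ∧ (∀ b : B, Nat.card (p ⁻¹' {b}) = 2) ∧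
      PathConnectedSpace B ∧ SimplyConnectedSpace B ∧
      ∀ x : E, LocPathConnectedSpace (pathComponent x) := by
  let φ : doubleArc ≃ₜ ULift doubleArc := Homeomorph.ulift.symm
  let ψ : Base ≃ₜ ULift Base := Homeomorph.ulift.symm
  have : ConnectedSpace doubleArc := isConnected_iff_connectedSpace.1 isConnected_doubleArc
  have hproj := isQuotientCoveringMap_proj.isCoveringMap
  have : SimplyConnectedSpace Base :=
    hproj.simplyConnectedSpace_of_isEmbedding isEmbedding_param
      bijective_proj_comp_param mem_range_param_of_joined
  have hE : ConnectedSpace (ULift doubleArc) := φ.surjective.connectedSpace φ.continuous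
  have hB : SimplyConnectedSpace (ULift Base) :=
    ψ.symm.toHomotopyEquiv.simplyConnectedSpace
  refine ⟨.of (ULift doubleArc), .of (ULift Base), ψ ∘ proj ∘ φ.symm, inferInstance, inferInstance,
    hE, inferInstance, (hproj.comp_homeomorph φ.symm).homeomorph_comp ψ, fun b ↦ ?_,
    inferInstance, hB, fun x ↦ ?_⟩
  · rw [← card_fiber_proj (ψ.symm b)]
    exact Nat.card_congr (φ.symm.toEquiv.subtypeEquiv fun x ↦ ψ.toEquiv.symm_apply_eq.symm)
  · have := locallyPathConnectedSpace_pathComponent (φ.symm x)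
    exact φ.locallyPathConnectedSpace_pathComponent x
end
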